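/- There exists a constant C > 0, depending only on Ω, r, u and κ, such that for every f ∈ C^∞ on the closure of Ω: ‖f‖_{H^{2, 1/(2κ)+1/2}} ≤ C ‖(A + I) f‖_{H^{0, 1/(2κ)-1/2}}, where I is the identity operator. -/

import Mathlib

open Set MeasureTheory

/-- Partial derivative in the `i`-th coordinate direction. -/
noncomputable def pd {n : ℕ} (i : Fin n) (f : (Fin n → ℝ) → ℝ) : (Fin n → ℝ) → ℝ :=
  fun x => fderiv ℝ f x (Pi.single i 1)

/-- Iterated partial derivative `∂^β f` for an (ordered) multi-index `β` of length `k`. -/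
noncomputable def mderiv {n k : ℕ} (β : Fin k → Fin n) (f : (Fin n → ℝ) → ℝ) :
    (Fin n → ℝ) → ℝ :=
  (List.ofFn β).foldr pd f

/-- `Ω` has a smooth boundary: it is the superlevel set of a smooth defining function whose
gradient does not vanish on the boundary. -/
def HasSmoothBoundary {n : ℕ} (Ω : Set (Fin n → ℝ)) : Prop :=
  ∃ ρ : (Fin n → ℝ) → ℝ, ContDiff ℝ (⊤ : ℕ∞) ρ ∧ Ω = {x | 0 < ρ x} ∧
    ∀ x ∈ frontier Ω, ρ x = 0 ∧ fderiv ℝ ρ x ≠ 0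

/-- The matrix field `H^{ij} = δ^{ij} - u^i u^j / (u^0)²`. -/
noncomputable def Hcoef (u : (Fin 3 → ℝ) → Fin 4 → ℝ) (i j : Fin 3)
    (x : Fin 3 → ℝ) : ℝ :=
  (if i = j then (1:ℝ) else 0) - u x i.succ * u x j.succ / (u x 0) ^ 2

/-- The degenerate elliptic operator
`L̃₁ f = (κ+1) H^{ij} (r ∂_i ∂_j f + (1/κ)(∂_i r)(∂_j f))`. -/
noncomputable def L1t (κ : ℝ) (r : (Fin 3 → ℝ) → ℝ) (u : (Fin 3 → ℝ) → Fin 4 → ℝ)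
    (f : (Fin 3 → ℝ) → ℝ) (x : Fin 3 → ℝ) : ℝ :=
  (κ + 1) * ∑ i, ∑ j, Hcoef u i j x *
    (r x * pd i (pd j f) x + (1/κ) * pd i r x * pd j f x)

/-- The weighted elliptic operator (up to sign, `L̂₁` of the paper)
`A f = -(κ+1) r^{1-1/κ} ∂_i (r^{1/κ} H^{ij} ∂_j f)`. -/
noncomputable def Aop (κ : ℝ) (r : (Fin 3 → ℝ) → ℝ) (u : (Fin 3 → ℝ) → Fin 4 → ℝ)
    (f : (Fin 3 → ℝ) → ℝ) (x : Fin 3 → ℝ) : ℝ :=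
  -(κ + 1) * r x ^ ((1:ℝ) - 1/κ) *
    ∑ i, pd i (fun y => r y ^ (1/κ) * ∑ j, Hcoef u i j y * pd j f y) x

/-- The weighted Sobolev norm with weight `r`:
`‖f‖_{H^{j,σ}}² = Σ_{|β| ≤ j} ∫_Ω r^{2σ} |∂^β f|² dx`. -/
noncomputable def rSobNorm (Ω : Set (Fin 3 → ℝ)) (r : (Fin 3 → ℝ) → ℝ) (j : ℕ) (σ : ℝ)
    (f : (Fin 3 → ℝ) → ℝ) : ℝ :=
  Real.sqrt (∑ k ∈ Finset.range (j + 1), ∑ β : Fin k → Fin 3,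
    ∫ x in Ω, r x ^ (2 * σ) * (mderiv β f x) ^ 2)

open Filter Topology
open scoped ContDiff

/-- At a boundary point of `{ρ > 0}` where the derivative of `ρ` does not vanish, derivatives
within the closure are unique. -/
lemma uniqueDiffWithinAt_closure_of_superlevel {E : Type*} [NormedAddCommGroup E]
    [NormedSpace ℝ E] {ρ : E → ℝ} {x : E} (hρ : DifferentiableAt ℝ ρ x) (h0 : ρ x = 0)
    (hd : fderiv ℝ ρ x ≠ 0) (hx : x ∈ closure {y | 0 < ρ y}) :
    UniqueDiffWithinAt ℝ (closure {y | 0 < ρ y}) x := by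
  set L := fderiv ℝ ρ x with hL
  have key : ∀ v, 0 < L v →
      v ∈ Submodule.span ℝ (tangentConeAt ℝ (closure {y | 0 < ρ y}) x) := by
    intro v hv
    have h1 : HasDerivAt (fun t : ℝ => ρ (x + t • v)) (L v) 0 := by
      have h2 : HasFDerivAt ρ L (x + (0 : ℝ) • v) := by simpa using hρ.hasFDerivAt
      have h3 : HasDerivAt (fun t : ℝ => x + t • v) v 0 := by
        simpa using ((hasDerivAt_id (0 : ℝ)).smul_const v).const_add x
      exact h2.comp_hasDerivAt (0 : ℝ) h3
    have h4 : ∀ᶠ t in 𝓝[>] (0 : ℝ), 0 < ρ (x + t • v) := by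
      have h5 := (hasDerivAt_iff_tendsto_slope.1 h1).eventually (lt_mem_nhds hv)
      have h6 : 𝓝[>] (0 : ℝ) ≤ 𝓝[≠] 0 := nhdsWithin_mono _ fun t ht => ne_of_gt ht
      filter_upwards [h6 h5, self_mem_nhdsWithin] with t ht (ht0 : 0 < t)
      simp only [slope_def_field, sub_zero, zero_smul, add_zero, h0] at ht
      exact (div_pos_iff_of_pos_right ht0).1 ht
    obtain ⟨δ, hδ, hsub⟩ := (mem_nhdsGT_iff_exists_Ioo_subset).1 h4
    have hδ : 0 < δ := hδ
    have h7 : δ • v ∈ tangentConeAt ℝ (closure {y | 0 < ρ y}) x := by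
      have := mem_tangentConeAt_of_openSegment_subset (x := x) (y := x + δ • v)
        (s := closure {y | 0 < ρ y}) ?_
      · simpa using this
      · rw [openSegment_eq_image']
        rintro _ ⟨t, ht, rfl⟩
        apply subset_closure
        have := hsub (show t * δ ∈ Ioo 0 δ from
          ⟨mul_pos ht.1 hδ, by nlinarith [ht.2]⟩)
        simpa [smul_smul] using this
    have := Submodule.smul_mem _ δ⁻¹ (Submodule.subset_span (R := ℝ) h7)
    simpa [smul_smul, hδ.ne'] using this
  refine ⟨?_, subset_closure hx⟩
  have : Submodule.span ℝ (tangentConeAt ℝ (closure {y | 0 < ρ y}) x) = ⊤ := by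
    obtain ⟨w, hw⟩ : ∃ w, 0 < L w := by
      by_contra! h
      apply hd
      ext v
      have h1 := h v
      have h2 := h (-v)
      simp only [map_neg] at h2
      simp
      linarith
    rw [eq_top_iff]
    intro v _
    obtain ⟨n, hn⟩ : ∃ n : ℝ, 0 < L (v + n • w) := by
      refine ⟨(1 - L v) / L w, ?_⟩
      simp [div_mul_cancel₀ _ hw.ne']
    have := Submodule.sub_mem _ (key _ hn) (Submodule.smul_mem _ n (key _ hw))
    simpa using this
  rw [this]
  exact dense_univ

lemma uniqueDiffOn_closure_of_hasSmoothBoundary {n : ℕ} {Ω : Set (Fin n → ℝ)}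
    (hΩo : IsOpen Ω) (hΩs : HasSmoothBoundary Ω) : UniqueDiffOn ℝ (closure Ω) := by
  obtain ⟨ρ, hρ, hΩ, hfr⟩ := hΩs
  intro x hx
  by_cases hxi : x ∈ Ω
  · exact (hΩo.uniqueDiffWithinAt hxi).mono subset_closure
  · have h := hfr x ⟨hx, by rwa [hΩo.interior_eq]⟩
    rw [hΩ] at hx ⊢
    exact uniqueDiffWithinAt_closure_of_superlevel
      ((hρ.differentiable (by simp)).differentiableAt) h.1 h.2 hx

/-- Functions that agree on `Ω` with a function smooth up to the boundary. -/
def SmoothUpTo {n : ℕ} (Ω : Set (Fin n → ℝ)) (f : (Fin n → ℝ) → ℝ) : Prop :=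
  ∃ g, ContDiffOn ℝ ∞ g (closure Ω) ∧ EqOn f g Ω

namespace SmoothUpTo

variable {n : ℕ} {Ω : Set (Fin n → ℝ)} {f g : (Fin n → ℝ) → ℝ}

lemma of_contDiffOn (hf : ContDiffOn ℝ ∞ f (closure Ω)) : SmoothUpTo Ω f :=
  ⟨f, hf, fun _ _ => rfl⟩

lemma const (c : ℝ) : SmoothUpTo Ω (fun _ => c) := of_contDiffOn contDiffOn_const

lemma mul (hf : SmoothUpTo Ω f) (hg : SmoothUpTo Ω g) : SmoothUpTo Ω (fun x => f x * g x) := by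
  obtain ⟨f', hf', ef⟩ := hf
  obtain ⟨g', hg', eg⟩ := hg
  exact ⟨_, hf'.mul hg', fun x hx => by simp [ef hx, eg hx]⟩

lemma add (hf : SmoothUpTo Ω f) (hg : SmoothUpTo Ω g) : SmoothUpTo Ω (fun x => f x + g x) := by
  obtain ⟨f', hf', ef⟩ := hf
  obtain ⟨g', hg', eg⟩ := hg
  exact ⟨_, hf'.add hg', fun x hx => by simp [ef hx, eg hx]⟩

lemma sub (hf : SmoothUpTo Ω f) (hg : SmoothUpTo Ω g) : SmoothUpTo Ω (fun x => f x - g x) := by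
  obtain ⟨f', hf', ef⟩ := hf
  obtain ⟨g', hg', eg⟩ := hg
  exact ⟨_, hf'.sub hg', fun x hx => by simp [ef hx, eg hx]⟩

lemma sum {ι : Type*} (s : Finset ι) {F : ι → (Fin n → ℝ) → ℝ}
    (hF : ∀ i ∈ s, SmoothUpTo Ω (F i)) : SmoothUpTo Ω (fun x => ∑ i ∈ s, F i x) := by
  classical
  induction s using Finset.induction_on with
  | empty => simpa using const 0
  | insert a s ha ih =>
    simp only [Finset.sum_insert ha]
    exact (hF a (by simp)).add (ih fun i hi => hF i (by simp [hi]))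

lemma congr (hf : SmoothUpTo Ω f) (h : EqOn g f Ω) : SmoothUpTo Ω g := by
  obtain ⟨f', hf', ef⟩ := hf
  exact ⟨f', hf', h.trans ef⟩

lemma contDiffOn (hf : SmoothUpTo Ω f) : ContDiffOn ℝ ∞ f Ω := by
  obtain ⟨f', hf', ef⟩ := hf
  exact (hf'.mono subset_closure).congr ef

lemma contDiffAt (hf : SmoothUpTo Ω f) (hΩo : IsOpen Ω) {x : Fin n → ℝ} (hx : x ∈ Ω) :
    ContDiffAt ℝ ∞ f x :=
  hf.contDiffOn.contDiffAt (hΩo.mem_nhds hx)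

lemma differentiableAt (hf : SmoothUpTo Ω f) (hΩo : IsOpen Ω) {x : Fin n → ℝ} (hx : x ∈ Ω) :
    DifferentiableAt ℝ f x :=
  (hf.contDiffAt hΩo hx).differentiableAt (by simp)

lemma pd (hf : SmoothUpTo Ω f) (hΩo : IsOpen Ω) (hu : UniqueDiffOn ℝ (closure Ω)) (i : Fin n) :
    SmoothUpTo Ω (pd i f) := by
  obtain ⟨f', hf', ef⟩ := hf
  refine ⟨fun x => fderivWithin ℝ f' (closure Ω) x (Pi.single i 1),
    (hf'.fderivWithin hu (by simp)).clm_apply contDiffOn_const, fun x hx => ?_⟩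
  have h1 : closure Ω ∈ 𝓝 x := mem_of_superset (hΩo.mem_nhds hx) subset_closure
  simp only [_root_.pd, fderivWithin_of_mem_nhds h1]
  rw [(ef.eventuallyEq_of_mem (hΩo.mem_nhds hx)).fderiv_eq]

lemma exists_bound (hf : SmoothUpTo Ω f) (hΩb : Bornology.IsBounded Ω) :
    ∃ M, 0 ≤ M ∧ ∀ x ∈ Ω, |f x| ≤ M := by
  obtain ⟨f', hf', ef⟩ := hf
  obtain ⟨M, hM⟩ := hΩb.isCompact_closure.exists_bound_of_continuousOn hf'.continuousOn
  refine ⟨max M 0, le_max_right _ _, fun x hx => ?_⟩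
  rw [ef hx]
  exact (hM x (subset_closure hx)).trans (le_max_left _ _)

lemma pd_comm (hf : SmoothUpTo Ω f) (hΩo : IsOpen Ω) (i j : Fin n)
    {x : Fin n → ℝ} (hx : x ∈ Ω) :
    _root_.pd i (_root_.pd j f) x = _root_.pd j (_root_.pd i f) x := by
  have h := hf.contDiffAt hΩo hx
  have hs : IsSymmSndFDerivAt ℝ f x := h.isSymmSndFDerivAt
    (by simpa using (WithTop.coe_le_coe.2 le_top : ((2 : ℕ∞) : ℕ∞ω) ≤ ∞))
  have hd : DifferentiableAt ℝ (fderiv ℝ f) x :=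
    (h.fderiv_right (m := 1)
      (WithTop.coe_le_coe.2 le_top : ((2 : ℕ∞) : ℕ∞ω) ≤ ∞)).differentiableAt (by simp)
  have e : ∀ i j : Fin n, _root_.pd i (_root_.pd j f) x
      = fderiv ℝ (fderiv ℝ f) x (Pi.single i 1) (Pi.single j 1) := by
    intro i j
    unfold _root_.pd
    rw [fderiv_clm_apply hd (by fun_prop)]
    simp
  rw [e, e, hs.eq]

end SmoothUpTo

lemma pd_mul {n : ℕ} {f g : (Fin n → ℝ) → ℝ} {x : Fin n → ℝ} (i : Fin n)
    (hf : DifferentiableAt ℝ f x) (hg : DifferentiableAt ℝ g x) :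
    pd i (fun y => f y * g y) x = f x * pd i g x + pd i f x * g x := by
  unfold pd
  rw [fderiv_fun_mul hf hg]
  simp
  ring

lemma pd_sum {n : ℕ} {ι : Type*} (s : Finset ι) {F : ι → (Fin n → ℝ) → ℝ} {x : Fin n → ℝ}
    (i : Fin n) (hF : ∀ k ∈ s, DifferentiableAt ℝ (F k) x) :
    pd i (fun y => ∑ k ∈ s, F k y) x = ∑ k ∈ s, pd i (F k) x := by
  unfold pd
  rw [fderiv_fun_sum hF]
  simp

lemma pd_comp {n : ℕ} {φ : ℝ → ℝ} {r : (Fin n → ℝ) → ℝ} {x : Fin n → ℝ} {d : ℝ} (i : Fin n)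
    (hφ : HasDerivAt φ d (r x)) (hr : DifferentiableAt ℝ r x) :
    pd i (fun y => φ (r y)) x = d * pd i r x := by
  unfold pd
  have := (hφ.comp_hasFDerivAt x hr.hasFDerivAt).fderiv
  simp only [Function.comp_def] at this
  rw [this]
  simp

/-- A differentiable function supported in a compact subset of `Ω` has partial derivatives of
vanishing integral. -/
lemma integral_pd_eq_zero_of_compact {n : ℕ} {Ω K : Set (Fin n → ℝ)} {G : (Fin n → ℝ) → ℝ}
    (hΩo : IsOpen Ω) (hK : IsCompact K) (hKΩ : K ⊆ Ω) (hG : ContDiffOn ℝ 1 G Ω)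
    (h0 : ∀ x ∈ Ω, x ∉ K → G x = 0) (i : Fin n) :
    IntegrableOn (pd i G) Ω ∧ ∫ x in Ω, pd i G x = 0 := by
  set k := Ω.indicator G with hk
  have hk0 : ∀ x, x ∉ K → k x = 0 := by
    intro x hx
    by_cases hxΩ : x ∈ Ω
    · simp [hk, hxΩ, h0 x hxΩ hx]
    · simp [hk, hxΩ]
  have hkG : ∀ x ∈ Ω, k =ᶠ[𝓝 x] G := fun x hx => by
    filter_upwards [hΩo.mem_nhds hx] with y hy using by simp [hk, hy]
  have hkz : ∀ x, x ∉ K → k =ᶠ[𝓝 x] fun _ => 0 := fun x hx => by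
    filter_upwards [hK.isClosed.isOpen_compl.mem_nhds hx] with y hy using hk0 y hy
  have hkc : ContDiff ℝ 1 k := by
    rw [contDiff_iff_contDiffAt]
    intro x
    by_cases hx : x ∈ Ω
    · exact (hG.contDiffAt (hΩo.mem_nhds hx)).congr_of_eventuallyEq (hkG x hx)
    · exact contDiffAt_const.congr_of_eventuallyEq (hkz x fun h => hx (hKΩ h))
  have hks : HasCompactSupport k := HasCompactSupport.intro hK hk0
  have hcont : Continuous (pd i k) := by
    have := hkc.continuous_fderiv (by simp)
    unfold pd
    fun_prop
  have hri : Integrable (pd i k) :=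
    hcont.integrable_of_hasCompactSupport (hks.fderiv_apply ℝ _)
  have hzero : ∫ x, pd i k x = 0 := by
    have := integral_mul_fderiv_eq_neg_fderiv_mul_of_integrable (μ := volume)
      (f := fun _ : Fin n → ℝ => (1 : ℝ)) (g := k) (v := Pi.single i 1) (by simp)
      (by simp only [one_mul]; exact hri)
      (by simpa using hkc.continuous.integrable_of_hasCompactSupport hks) (by simp)
      (fun x _ => (hkc.differentiable (by simp)).differentiableAt)
    simpa [pd] using this
  have heq : EqOn (pd i G) (pd i k) Ω := fun x hx => by
    simp only [pd, (hkG x hx).fderiv_eq]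
  refine ⟨hri.integrableOn.congr_fun heq.symm hΩo.measurableSet, ?_⟩
  rw [setIntegral_congr_fun hΩo.measurableSet heq, ← hzero]
  refine setIntegral_eq_integral_of_forall_compl_eq_zero fun x hx => ?_
  simp only [pd, (hkz x fun h => hx (hKΩ h)).fderiv_eq]
  simp

lemma isCompact_superlevel {n : ℕ} {Ω : Set (Fin n → ℝ)} {r : (Fin n → ℝ) → ℝ}
    (hΩo : IsOpen Ω) (hΩb : Bornology.IsBounded Ω) (hr : ContinuousOn r (closure Ω))
    (hr0 : ∀ x ∈ frontier Ω, r x = 0) {ε : ℝ} (hε : 0 < ε) :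
    IsCompact {x | x ∈ closure Ω ∧ ε ≤ r x} ∧ {x | x ∈ closure Ω ∧ ε ≤ r x} ⊆ Ω := by
  constructor
  · have := hr.preimage_isClosed_of_isClosed isClosed_closure (isClosed_Ici (a := ε))
    exact hΩb.isCompact_closure.of_isClosed_subset this fun x hx => hx.1
  · rintro x ⟨hx, hxr⟩
    by_contra h
    have := hr0 x ⟨hx, by rwa [hΩo.interior_eq]⟩
    linarith

/-- A smooth cutoff function, vanishing on `(-∞, 1]` and equal to one on `[2, ∞)`. -/
noncomputable def cutoff (t : ℝ) : ℝ := Real.smoothTransition (t - 1)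

lemma contDiff_cutoff : ContDiff ℝ 1 cutoff :=
  (Real.smoothTransition.contDiff (n := 1)).comp (contDiff_id.sub contDiff_const)

lemma cutoff_eq_zero {t : ℝ} (h : t ≤ 1) : cutoff t = 0 :=
  Real.smoothTransition.zero_of_nonpos (by linarith)

lemma cutoff_eq_one {t : ℝ} (h : 2 ≤ t) : cutoff t = 1 :=
  Real.smoothTransition.one_of_one_le (by linarith)

lemma cutoff_nonneg (t : ℝ) : 0 ≤ cutoff t := Real.smoothTransition.nonneg _

lemma cutoff_le_one (t : ℝ) : cutoff t ≤ 1 := Real.smoothTransition.le_one _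

lemma deriv_cutoff_nonneg (t : ℝ) : 0 ≤ deriv cutoff t :=
  Monotone.deriv_nonneg fun _ _ h => Real.smoothTransition.monotone (by linarith)

lemma deriv_cutoff_eq_zero_of_lt_one {t : ℝ} (h : t < 1) : deriv cutoff t = 0 := by
  have : cutoff =ᶠ[𝓝 t] fun _ => 0 := by
    filter_upwards [Iio_mem_nhds h] with s hs using cutoff_eq_zero hs.le
  simp [this.deriv_eq]

lemma deriv_cutoff_eq_zero {t : ℝ} (h : 2 < t) : deriv cutoff t = 0 := by
  have : cutoff =ᶠ[𝓝 t] fun _ => 1 := by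
    filter_upwards [Ioi_mem_nhds h] with s hs using cutoff_eq_one hs.le
  simp [this.deriv_eq]

lemma exists_bound_mul_deriv_cutoff : ∃ M, 0 ≤ M ∧ ∀ t, |deriv cutoff t * t| ≤ M := by
  have hc : Continuous (fun t => deriv cutoff t * t) :=
    (contDiff_cutoff.continuous_deriv (by simp)).mul continuous_id
  obtain ⟨M, hM⟩ := isCompact_Icc.exists_bound_of_continuousOn (s := Icc (1 : ℝ) 2) hc.continuousOn
  refine ⟨max M 0, le_max_right _ _, fun t => ?_⟩
  by_cases h1 : t < 1
  · simp [deriv_cutoff_eq_zero_of_lt_one h1]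
  by_cases h2 : 2 < t
  · simp [deriv_cutoff_eq_zero h2]
  · exact (hM t ⟨not_lt.1 h1, not_lt.1 h2⟩).trans (le_max_left _ _)

section WeightedIBP

variable {n : ℕ} {Ω : Set (Fin n → ℝ)} {r : (Fin n → ℝ) → ℝ}

lemma integral_cutoff_ibp (hΩo : IsOpen Ω) (hΩb : Bornology.IsBounded Ω)
    (hr : ContDiffOn ℝ ∞ r (closure Ω)) (hrpos : ∀ x ∈ Ω, 0 < r x)
    (hr0 : ∀ x ∈ frontier Ω, r x = 0) (b : ℝ) {ε : ℝ} (hε : 0 < ε)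
    {G : (Fin n → ℝ) → ℝ} (hG : SmoothUpTo Ω G) (i : Fin n) :
    IntegrableOn (fun x => r x ^ (b - 1) * (deriv cutoff (r x / ε) * (r x / ε) * pd i r x * G x
        + cutoff (r x / ε) * (r x * pd i G x + b * pd i r x * G x))) Ω ∧
      ∫ x in Ω, r x ^ (b - 1) * (deriv cutoff (r x / ε) * (r x / ε) * pd i r x * G x
        + cutoff (r x / ε) * (r x * pd i G x + b * pd i r x * G x)) = 0 := by
  obtain ⟨hK, hKΩ⟩ := isCompact_superlevel hΩo hΩb hr.continuousOn hr0 hε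
  set F : (Fin n → ℝ) → ℝ := fun x => (cutoff (r x / ε) * r x ^ b) * G x
  have hrs : SmoothUpTo Ω r := .of_contDiffOn hr
  have hφ : ∀ x ∈ Ω, ContDiffAt ℝ 1 (fun y => cutoff (r y / ε) * r y ^ b) x := by
    intro x hx
    have h1 : ContDiffAt ℝ 1 r x := (hrs.contDiffAt hΩo hx).of_le (by simp)
    exact ((contDiff_cutoff.contDiffAt).comp x (h1.div_const ε)).mul
      (h1.rpow_const_of_ne (hrpos x hx).ne')
  have hF : ContDiffOn ℝ 1 F Ω := fun x hx =>
    ((hφ x hx).mul ((hG.contDiffAt hΩo hx).of_le (by simp))).contDiffWithinAt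
  have key := integral_pd_eq_zero_of_compact hΩo hK hKΩ hF (fun x hx hxK => by
    have : r x < ε := by
      by_contra h
      exact hxK ⟨subset_closure hx, not_lt.1 h⟩
    simp [F, cutoff_eq_zero ((div_le_one hε).2 this.le)]) i
  have heq : EqOn (pd i F) (fun x => r x ^ (b - 1) * (deriv cutoff (r x / ε) * (r x / ε)
      * pd i r x * G x + cutoff (r x / ε) * (r x * pd i G x + b * pd i r x * G x))) Ω := by
    intro x hx
    have hrx := hrpos x hx
    have h1 : HasDerivAt (fun t => cutoff (t / ε) * t ^ b)
        (deriv cutoff (r x / ε) * (1 / ε) * r x ^ b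
          + cutoff (r x / ε) * (b * r x ^ (b - 1))) (r x) := by
      have hc : HasDerivAt cutoff (deriv cutoff (r x / ε)) (r x / ε) :=
        ((contDiff_cutoff.differentiable (by simp)) _).hasDerivAt
      exact (hc.comp (r x) ((hasDerivAt_id (r x)).div_const ε)).mul
        (Real.hasDerivAt_rpow_const (Or.inl hrx.ne'))
    have h2 := pd_comp i h1 (hrs.differentiableAt hΩo hx)
    have h3 := pd_mul i ((hφ x hx).differentiableAt (by simp)) (hG.differentiableAt hΩo hx)
    have h4 : r x ^ b = r x ^ (b - 1) * r x := by
      rw [← Real.rpow_add_one hrx.ne']; simp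
    simp only [F]
    rw [h3, h2, h4]
    field_simp
    ring
  exact ⟨key.1.congr_fun heq hΩo.measurableSet,
    by rw [← setIntegral_congr_fun hΩo.measurableSet heq]; exact key.2⟩

lemma integrableOn_rpow_sub_one (hΩo : IsOpen Ω) (hΩb : Bornology.IsBounded Ω)
    (hu : UniqueDiffOn ℝ (closure Ω))
    (hr : ContDiffOn ℝ ∞ r (closure Ω)) (hrpos : ∀ x ∈ Ω, 0 < r x)
    (hr0 : ∀ x ∈ frontier Ω, r x = 0) {c : ℝ} (hc : 0 < c)
    (hcr : ∀ x ∈ Ω, c ≤ ∑ i, pd i r x ^ 2 + r x) {b : ℝ} (hb : 0 < b) :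
    IntegrableOn (fun x => r x ^ (b - 1)) Ω := by
  have hrs : SmoothUpTo Ω r := .of_contDiffOn hr
  obtain ⟨R, hR0, hR⟩ := hrs.exists_bound hΩb
  obtain ⟨D, hD0, hD⟩ := (SmoothUpTo.sum Finset.univ fun i _ =>
    (hrs.pd hΩo hu i).pd hΩo hu i).exists_bound hΩb
  have hvol : volume Ω ≠ ⊤ := hΩb.measure_lt_top.ne
  set C := (b + D) * R ^ b with hC
  set S : ℝ → (Fin n → ℝ) → ℝ := fun ε x => ∑ i, r x ^ (b - 1) *
    (deriv cutoff (r x / ε) * (r x / ε) * pd i r x * pd i r x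
      + cutoff (r x / ε) * (r x * pd i (pd i r) x + b * pd i r x * pd i r x)) with hS
  have hSi : ∀ ε, 0 < ε → IntegrableOn (S ε) Ω := fun ε hε =>
    integrable_finsetSum _ fun i _ =>
      (integral_cutoff_ibp hΩo hΩb hr hrpos hr0 b hε (hrs.pd hΩo hu i) i).1
  have hS0 : ∀ ε, 0 < ε → ∫ x in Ω, S ε x = 0 := fun ε hε => by
    rw [hS, integral_finsetSum]
    · exact Finset.sum_eq_zero fun i _ =>
        (integral_cutoff_ibp hΩo hΩb hr hrpos hr0 b hε (hrs.pd hΩo hu i) i).2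
    · exact fun i _ =>
        (integral_cutoff_ibp hΩo hΩb hr hrpos hr0 b hε (hrs.pd hΩo hu i) i).1
  have hlow : ∀ ε, 0 < ε → ∀ x ∈ Ω,
      cutoff (r x / ε) * (b * c * r x ^ (b - 1)) ≤ S ε x + C := by
    intro ε hε x hx
    have hrx := hrpos x hx
    set A := ∑ i, pd i r x ^ 2 with hA
    have hA0 : 0 ≤ A := Finset.sum_nonneg fun i _ => sq_nonneg _
    set B := ∑ i, pd i (pd i r) x with hB
    have e1 : S ε x = r x ^ (b - 1) * (deriv cutoff (r x / ε) * (r x / ε) * A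
        + cutoff (r x / ε) * (r x * B + b * A)) := by
      simp only [hS, hA, hB, Finset.mul_sum, ← Finset.sum_add_distrib]
      exact Finset.sum_congr rfl fun i _ => by ring
    have h4 : r x ^ b = r x ^ (b - 1) * r x := by
      rw [← Real.rpow_add_one hrx.ne']; simp
    have h5 : r x ^ b ≤ R ^ b :=
      Real.rpow_le_rpow hrx.le ((le_abs_self _).trans (hR x hx)) hb.le
    have h6 : 0 < r x ^ (b - 1) := Real.rpow_pos_of_pos hrx _
    have h7 : 0 ≤ deriv cutoff (r x / ε) * (r x / ε) * A :=
      mul_nonneg (mul_nonneg (deriv_cutoff_nonneg _) (by positivity)) hA0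
    have h8 : -D ≤ B := (abs_le.1 (hD x hx)).1
    have h9 : c - r x ≤ A := by linarith [hcr x hx]
    have h10 : b * c - (b + D) * r x ≤ r x * B + b * A := by nlinarith
    have h11 := cutoff_nonneg (r x / ε)
    have h12 := cutoff_le_one (r x / ε)
    have h13 : cutoff (r x / ε) * ((b + D) * r x ^ b) ≤ C := by
      calc _ ≤ 1 * ((b + D) * r x ^ b) := by gcongr
        _ ≤ C := by rw [one_mul, hC]; gcongr
    have h14 : r x ^ (b - 1) * (cutoff (r x / ε) * (b * c - (b + D) * r x)) ≤ S ε x := by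
      rw [e1]
      gcongr
      nlinarith [mul_le_mul_of_nonneg_left h10 h11]
    rw [h4] at h13
    linarith
  set φ : ℕ → Set (Fin n → ℝ) := fun k => {x | x ∈ closure Ω ∧ 2 * (1 / ((k : ℝ) + 1)) ≤ r x}
  have hε : ∀ k : ℕ, 0 < 1 / ((k : ℝ) + 1) := fun k => by positivity
  have hφK : ∀ k, IsCompact (φ k) ∧ φ k ⊆ Ω := fun k =>
    isCompact_superlevel hΩo hΩb hr.continuousOn hr0 (by have := hε k; positivity)
  have hcov : AECover (volume.restrict Ω) atTop φ := by
    refine ⟨?_, fun k => (hφK k).1.measurableSet⟩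
    filter_upwards [ae_restrict_mem hΩo.measurableSet] with x hx
    have h1 : Tendsto (fun k : ℕ => 2 * (1 / ((k : ℝ) + 1))) atTop (𝓝 (2 * 0)) :=
      tendsto_one_div_add_atTop_nhds_zero_nat.const_mul 2
    rw [mul_zero] at h1
    filter_upwards [h1.eventually (gt_mem_nhds (hrpos x hx))] with k hk
    exact ⟨subset_closure hx, hk.le⟩
  have hcontr : ∀ k, IntegrableOn (fun x => r x ^ (b - 1)) (φ k) := fun k => by
    refine ContinuousOn.integrableOn_compact (hφK k).1 ?_
    exact (hr.continuousOn.mono fun x hx => hx.1).rpow_const fun x hx =>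
      Or.inl (hrpos x ((hφK k).2 hx)).ne'
  refine hcov.integrable_of_integral_norm_bounded (C * volume.real Ω / (b * c))
    (fun k => (hcontr k).mono_measure Measure.restrict_le_self) (Eventually.of_forall fun k => ?_)
  rw [Measure.restrict_restrict (hφK k).1.measurableSet, inter_eq_left.2 (hφK k).2]
  have hSC : IntegrableOn (fun x => S (1 / ((k : ℝ) + 1)) x + C) Ω :=
    (hSi _ (hε k)).add (integrableOn_const hvol)
  rw [le_div_iff₀ (by positivity), ← integral_mul_const]
  calc ∫ x in φ k, ‖r x ^ (b - 1)‖ * (b * c)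
      ≤ ∫ x in φ k, (S (1 / ((k : ℝ) + 1)) x + C) := by
        refine setIntegral_mono_on ((hcontr k).norm.mul_const _) (hSC.mono_set (hφK k).2)
          (hφK k).1.measurableSet fun x hx => ?_
        have h := hlow _ (hε k) x ((hφK k).2 hx)
        rw [cutoff_eq_one ((le_div_iff₀ (hε k)).2 hx.2), one_mul] at h
        rw [Real.norm_of_nonneg (Real.rpow_nonneg (hrpos x ((hφK k).2 hx)).le _)]
        linarith
    _ ≤ ∫ x in Ω, (S (1 / ((k : ℝ) + 1)) x + C) := by
        refine setIntegral_mono_set hSC ?_ (hφK k).2.eventuallyLE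
        filter_upwards [ae_restrict_mem hΩo.measurableSet] with x hx
        refine le_trans (mul_nonneg (cutoff_nonneg (r x / (1 / ((k : ℝ) + 1)))) ?_)
          (hlow _ (hε k) x hx)
        have := Real.rpow_nonneg (hrpos x hx).le (b - 1)
        positivity
    _ = C * volume.real Ω := by
        rw [integral_add (hSi _ (hε k)) (integrableOn_const hvol), hS0 _ (hε k)]
        simp [mul_comm]

lemma integrableOn_rpow_mul (hΩo : IsOpen Ω) (hΩb : Bornology.IsBounded Ω)
    {b : ℝ} (hri : IntegrableOn (fun x => r x ^ (b - 1)) Ω)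
    {G : (Fin n → ℝ) → ℝ} (hG : SmoothUpTo Ω G) :
    IntegrableOn (fun x => r x ^ (b - 1) * G x) Ω := by
  obtain ⟨M, _, hM⟩ := hG.exists_bound hΩb
  refine Integrable.mul_bdd (c := M) hri
    (hG.contDiffOn.continuousOn.aestronglyMeasurable hΩo.measurableSet) ?_
  filter_upwards [ae_restrict_mem hΩo.measurableSet] with x hx using hM x hx

/-- Weighted integration by parts: `∫_Ω ∂_i (r^b G) = 0` for `b > 0`. -/
lemma integral_weighted_ibp (hΩo : IsOpen Ω) (hΩb : Bornology.IsBounded Ω)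
    (hu : UniqueDiffOn ℝ (closure Ω))
    (hr : ContDiffOn ℝ ∞ r (closure Ω)) (hrpos : ∀ x ∈ Ω, 0 < r x)
    (hr0 : ∀ x ∈ frontier Ω, r x = 0) {b : ℝ}
    (hri : IntegrableOn (fun x => r x ^ (b - 1)) Ω)
    {G : (Fin n → ℝ) → ℝ} (hG : SmoothUpTo Ω G) (i : Fin n) :
    ∫ x in Ω, r x ^ (b - 1) * (r x * pd i G x + b * pd i r x * G x) = 0 := by
  have hrs : SmoothUpTo Ω r := .of_contDiffOn hr
  obtain ⟨M, hM0, hM⟩ := exists_bound_mul_deriv_cutoff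
  have s1 : SmoothUpTo Ω (fun x => pd i r x * G x) := (hrs.pd hΩo hu i).mul hG
  have s2 : SmoothUpTo Ω (fun x => r x * pd i G x + b * pd i r x * G x) :=
    (hrs.mul (hG.pd hΩo hu i)).add (((SmoothUpTo.const b).mul (hrs.pd hΩo hu i)).mul hG)
  obtain ⟨M1, hM10, hM1⟩ := s1.exists_bound hΩb
  obtain ⟨M2, hM20, hM2⟩ := s2.exists_bound hΩb
  have hε : ∀ k : ℕ, 0 < 1 / ((k : ℝ) + 1) := fun k => by positivity
  have lim := tendsto_integral_of_dominated_convergence (μ := volume.restrict Ω)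
    (F := fun (k : ℕ) x => r x ^ (b - 1) * (deriv cutoff (r x / (1 / ((k : ℝ) + 1)))
        * (r x / (1 / ((k : ℝ) + 1))) * pd i r x * G x
        + cutoff (r x / (1 / ((k : ℝ) + 1))) * (r x * pd i G x + b * pd i r x * G x)))
    (f := fun x => r x ^ (b - 1) * (r x * pd i G x + b * pd i r x * G x))
    (fun x => r x ^ (b - 1) * (M * M1 + M2))
    (fun k => (integral_cutoff_ibp hΩo hΩb hr hrpos hr0 b (hε k) hG i).1.aestronglyMeasurable)
    (hri.mul_const _) ?_ ?_
  · refine tendsto_nhds_unique lim ?_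
    simp only [(integral_cutoff_ibp hΩo hΩb hr hrpos hr0 b (hε _) hG i).2]
    exact tendsto_const_nhds
  · intro k
    filter_upwards [ae_restrict_mem hΩo.measurableSet] with x hx
    have h6 : 0 < r x ^ (b - 1) := Real.rpow_pos_of_pos (hrpos x hx) _
    rw [norm_mul, Real.norm_of_nonneg h6.le]
    gcongr
    refine (norm_add_le _ _).trans ?_
    rw [mul_assoc _ (pd i r x), norm_mul, norm_mul (cutoff _)]
    refine add_le_add (mul_le_mul (hM _) (hM1 x hx) (norm_nonneg _) hM0) ?_
    rw [Real.norm_of_nonneg (cutoff_nonneg _)]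
    calc _ ≤ 1 * M2 := mul_le_mul (cutoff_le_one _) (hM2 x hx) (abs_nonneg _) zero_le_one
      _ = M2 := one_mul _
  · filter_upwards [ae_restrict_mem hΩo.measurableSet] with x hx
    have h1 : Tendsto (fun k : ℕ => 2 * (1 / ((k : ℝ) + 1))) atTop (𝓝 (2 * 0)) :=
      tendsto_one_div_add_atTop_nhds_zero_nat.const_mul 2
    rw [mul_zero] at h1
    refine tendsto_const_nhds.congr' ?_
    filter_upwards [h1.eventually (gt_mem_nhds (hrpos x hx))] with k hk
    have h2 : 2 < r x / (1 / ((k : ℝ) + 1)) := (lt_div_iff₀ (hε k)).2 hk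
    rw [deriv_cutoff_eq_zero h2, cutoff_eq_one h2.le]
    ring

end WeightedIBP

section PointwiseAlgebra

lemma sq_sum_mul_le {c x : Fin 3 → ℝ} {m : ℝ} (hc : ∀ l, |c l| ≤ m) :
    (∑ l, c l * x l) ^ 2 ≤ 3 * m ^ 2 * ∑ l, x l ^ 2 := by
  refine (Finset.sum_mul_sq_le_sq_mul_sq _ _ _).trans ?_
  gcongr
  calc ∑ l, c l ^ 2 ≤ ∑ _l : Fin 3, m ^ 2 :=
        Finset.sum_le_sum fun l _ => sq_le_sq' (abs_le.1 (hc l)).1 (abs_le.1 (hc l)).2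
    _ = 3 * m ^ 2 := by simp

lemma abs_mul_le_of_sq_le {x y N : ℝ} (hx : x ^ 2 ≤ N) (hy : y ^ 2 ≤ N) : |x * y| ≤ N := by
  rw [abs_le]
  constructor <;> nlinarith [sq_nonneg (x - y), sq_nonneg (x + y)]

/-- Lower bound for `tr (H F H F)` with `H = 1 - v ⊗ v` and `F` symmetric. -/
lemma trace_sq_lower_bound {h q : Fin 3 → Fin 3 → ℝ} {v : Fin 3 → ℝ} {lam : ℝ}
    (hh : ∀ i j, h i j = (if i = j then 1 else 0) - v i * v j)
    (hlam : 0 ≤ lam) (hv : lam ≤ 1 - ∑ i, v i ^ 2) (hq : ∀ i j, q i j = q j i) :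
    lam ^ 2 * ∑ i, ∑ j, q i j ^ 2 ≤ ∑ j, ∑ k, (∑ l, h j l * q k l) * (∑ l, h k l * q j l) := by
  have hpos : ∀ ξ : Fin 3 → ℝ, lam * ∑ i, ξ i ^ 2 ≤ ∑ i, ∑ j, h i j * ξ i * ξ j := by
    intro ξ
    have hN : 0 ≤ ∑ i, ξ i ^ 2 := Finset.sum_nonneg fun i _ => sq_nonneg _
    refine (mul_le_mul_of_nonneg_right hv hN).trans ?_
    simp only [Fin.sum_univ_three, hh]
    simp
    nlinarith [sq_nonneg (ξ 0 * v 1 - ξ 1 * v 0), sq_nonneg (ξ 0 * v 2 - ξ 2 * v 0),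
      sq_nonneg (ξ 1 * v 2 - ξ 2 * v 1)]
  have hpos0 : ∀ ξ : Fin 3 → ℝ, 0 ≤ ∑ i, ∑ j, h i j * ξ i * ξ j := fun ξ =>
    (mul_nonneg hlam (Finset.sum_nonneg fun i _ => sq_nonneg _)).trans (hpos ξ)
  have e : ∑ j, ∑ k, (∑ l, h j l * q k l) * (∑ l, h k l * q j l)
      = (1 - ∑ i, v i ^ 2) * (∑ m, ∑ i, ∑ j, h i j * q i m * q j m)
        + ((∑ i, ∑ j, h i j * (v 1 * q i 0 - v 0 * q i 1) * (v 1 * q j 0 - v 0 * q j 1))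
        + (∑ i, ∑ j, h i j * (v 2 * q i 0 - v 0 * q i 2) * (v 2 * q j 0 - v 0 * q j 2))
        + (∑ i, ∑ j, h i j * (v 2 * q i 1 - v 1 * q i 2) * (v 2 * q j 1 - v 1 * q j 2))) := by
    simp only [Fin.sum_univ_three, hh, hq 1 0, hq 2 0, hq 2 1]
    simp
    ring
  rw [e]
  have h1 := hpos0 (fun i => v 1 * q i 0 - v 0 * q i 1)
  have h2 := hpos0 (fun i => v 2 * q i 0 - v 0 * q i 2)
  have h3 := hpos0 (fun i => v 2 * q i 1 - v 1 * q i 2)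
  have h4 : lam * ∑ i, ∑ j, q i j ^ 2 ≤ ∑ m, ∑ i, ∑ j, h i j * q i m * q j m := by
    rw [Finset.sum_comm, Finset.mul_sum]
    exact Finset.sum_le_sum fun m _ => hpos fun i => q i m
  have h5 : 0 ≤ ∑ m, ∑ i, ∑ j, h i j * q i m * q j m :=
    Finset.sum_nonneg fun m _ => hpos0 fun i => q i m
  have h6 : lam * (lam * ∑ i, ∑ j, q i j ^ 2)
      ≤ (1 - ∑ i, v i ^ 2) * ∑ m, ∑ i, ∑ j, h i j * q i m * q j m :=
    (mul_le_mul_of_nonneg_left h4 hlam).trans (mul_le_mul_of_nonneg_right hv h5)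
  linarith [show lam ^ 2 * ∑ i, ∑ j, q i j ^ 2 = lam * (lam * ∑ i, ∑ j, q i j ^ 2) by ring]

lemma energy_pointwise {κ F L g ρ S N d lam : ℝ} (hκ : 0 < κ) (hρ : 0 ≤ ρ)
    (hg : g = F - (κ + 1) * L) (hS : lam * N ≤ S) (hd : d = F * L + ρ * S) :
    F ^ 2 + 2 * (κ + 1) * lam * (ρ * N) ≤ g ^ 2 + 2 * (κ + 1) * d := by
  have h1 : (κ + 1) * (ρ * (lam * N)) ≤ (κ + 1) * (ρ * S) := by gcongr
  have h2 : g ^ 2 + 2 * (κ + 1) * d - F ^ 2 - 2 * ((κ + 1) * (ρ * S)) = ((κ + 1) * L) ^ 2 := by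
    rw [hg, hd]; ring
  nlinarith [sq_nonneg ((κ + 1) * L)]

lemma rellich_pointwise {a c lam M L T ρ Q A S N d : ℝ} (ha : 0 < a) (hc : 0 < c)
    (hlam : 0 < lam) (hM : 0 < M) (hρ : 0 ≤ ρ) (hN : 0 ≤ N) (hA : c - ρ ≤ A)
    (hS : lam * N ≤ S) (hS' : S ≤ M * N) (hT : T ^ 2 ≤ M * N) (hQ : Q ≤ M * N)
    (hd : d = L * T + ρ * Q - a / 2 * A * S) :
    a * c * lam / 4 * N ≤ M / (a * c * lam) * L ^ 2 + (1 + a / 2) * M * (ρ * N) - d := by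
  have hS0 : 0 ≤ S := (mul_nonneg hlam.le hN).trans hS
  have h1 : a / 2 * (c * (lam * N)) ≤ a / 2 * (c * S) := by gcongr
  have h2 : a / 2 * ((c - ρ) * S) ≤ a / 2 * (A * S) := by gcongr
  have h3 : a / 2 * (ρ * S) ≤ a / 2 * (ρ * (M * N)) := by gcongr
  have h4 : ρ * Q ≤ ρ * (M * N) := by gcongr
  set θ := a * c * lam with hθ
  have hθ0 : 0 < θ := by positivity
  have h5 : L * T ≤ M / θ * L ^ 2 + θ / (4 * M) * T ^ 2 := by
    have : M / θ * L ^ 2 + θ / (4 * M) * T ^ 2 - L * T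
        = M / θ * (L - θ / (2 * M) * T) ^ 2 := by
      field_simp; ring
    have h6 : 0 ≤ M / θ * (L - θ / (2 * M) * T) ^ 2 := by positivity
    linarith
  have h6 : θ / (4 * M) * T ^ 2 ≤ θ / (4 * M) * (M * N) := by gcongr
  have h7 : θ / (4 * M) * (M * N) = θ / 4 * N := by field_simp
  have h8 : a / 2 * (c * (lam * N)) = θ / 2 * N := by rw [hθ]; ring
  nlinarith

lemma mul_le_young {s x y : ℝ} (hs : 0 < s) : x * y ≤ s * x ^ 2 + 1 / (4 * s) * y ^ 2 := by
  have : s * x ^ 2 + 1 / (4 * s) * y ^ 2 - x * y = s * (x - 1 / (2 * s) * y) ^ 2 := by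
    field_simp; ring
  have h6 : 0 ≤ s * (x - 1 / (2 * s) * y) ^ 2 := by positivity
  linarith

/-- Lower bound for one term of the second order identity, with `x = U k j`, `y = e k j`,
`x' = U j k`, `y' = e j k`, `z = ∂_k r P_j`. -/
lemma second_order_term {s t b ρ M N1 N2 x y x' y' z : ℝ} (hs : 0 ≤ s) (ht : 0 ≤ t)
    (hst : ∀ x y : ℝ, x * y ≤ s * x ^ 2 + t * y ^ 2) (hM : 0 ≤ M) (hN1 : 0 ≤ N1)
    (hρM : ρ ^ 2 ≤ M) (hx : x ^ 2 ≤ M * N2) (hx' : x' ^ 2 ≤ M * N2) (hy : y ^ 2 ≤ M * N1)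
    (hy' : y' ^ 2 ≤ M * N1) (hz : z ^ 2 ≤ M * N1) :
    ρ ^ 2 * (x * x') - 3 * s * M * (ρ ^ 2 * N2)
        - (2 * (M ^ 2 * t) + M ^ 2 + b ^ 2 * M * t + M ^ 2 + b ^ 2 * M) * N1
      ≤ ρ ^ 2 * ((x + y) * (x' + y')) + b * ρ * (z * (x' + y')) := by
  have hMN : 0 ≤ M * N1 := mul_nonneg hM hN1
  have hcross : ∀ x y : ℝ, x ^ 2 ≤ M * N2 → y ^ 2 ≤ M * N1 →
      -(s * (ρ ^ 2 * (M * N2)) + t * (M * (M * N1))) ≤ ρ ^ 2 * (x * y) := by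
    intro x y hx hy
    have h1 := hst (-(ρ * x)) (ρ * y)
    have h2 : s * (ρ ^ 2 * x ^ 2) ≤ s * (ρ ^ 2 * (M * N2)) := by gcongr
    have h3 : t * (ρ ^ 2 * y ^ 2) ≤ t * (M * (M * N1)) := by gcongr
    linarith
  have h1 := hcross _ _ hx hy'
  have h2 := hcross _ _ hx' hy
  have h3 : -(M * (M * N1)) ≤ ρ ^ 2 * (y * y') := by
    have h := mul_le_mul_of_nonneg_left (abs_le.1 (abs_mul_le_of_sq_le hy hy')).1 (sq_nonneg ρ)
    have h' : ρ ^ 2 * (M * N1) ≤ M * (M * N1) := by gcongr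
    linarith
  have h4 : -(s * (ρ ^ 2 * (M * N2)) + t * (b ^ 2 * (M * N1))) ≤ b * ρ * (z * x') := by
    have h1 := hst (-(ρ * x')) (b * z)
    have h2 : s * (ρ ^ 2 * x' ^ 2) ≤ s * (ρ ^ 2 * (M * N2)) := by gcongr
    have h3 : t * (b ^ 2 * z ^ 2) ≤ t * (b ^ 2 * (M * N1)) := by gcongr
    linarith
  have h5 : -(M * (M * N1) + b ^ 2 * (M * N1)) ≤ b * ρ * (z * y') := by
    have h1 : ρ ^ 2 * y' ^ 2 ≤ M * (M * N1) := by gcongr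
    have h2 : b ^ 2 * z ^ 2 ≤ b ^ 2 * (M * N1) := by gcongr
    linarith [sq_nonneg (ρ * y' + b * z), sq_nonneg (ρ * y'), sq_nonneg (b * z)]
  linarith

/-- Pointwise second order estimate. Here `U k j + e k j` stands for `∂_k P_j`, where `U` is of
second and `e` of first order. -/
lemma second_order_pointwise {a lam M : ℝ} (ha : 0 < a) (hlam : 0 < lam) (hM : 0 < M) :
    ∃ C, 0 ≤ C ∧ ∀ (L ρ N1 N2 d : ℝ) (dr P : Fin 3 → ℝ) (U e : Fin 3 → Fin 3 → ℝ),
      0 ≤ N1 → 0 ≤ N2 → ρ ^ 2 ≤ M →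
      L = ∑ i, (ρ * (U i i + e i i) + a * dr i * P i) →
      lam ^ 2 * N2 ≤ ∑ j, ∑ k, U k j * U j k →
      (∀ j k, U j k ^ 2 ≤ M * N2) → (∀ j k, e j k ^ 2 ≤ M * N1) →
      (∀ j k, (dr j * P k) ^ 2 ≤ M * N1) →
      d = ∑ j, ∑ k, (ρ ^ 2 * ((U j j + e j j) * (U k k + e k k)
          - (U k j + e k j) * (U j k + e j k))
        + (a + 1) * ρ * (dr j * P j * (U k k + e k k) - dr k * P j * (U j k + e j k))) →
      lam ^ 2 / 2 * (ρ ^ 2 * N2) ≤ (a + 3) * L ^ 2 + C * N1 - d := by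
  set s := lam ^ 2 / (54 * M) with hs
  have hs0 : 0 < s := by positivity
  set K := 2 * (M ^ 2 * (1 / (4 * s))) + M ^ 2 + (a + 1) ^ 2 * M * (1 / (4 * s)) + M ^ 2
    + (a + 1) ^ 2 * M with hK
  refine ⟨9 * M * (2 * a ^ 2 + (a + 1)) + 9 * K, by positivity, ?_⟩
  intro L ρ N1 N2 d dr P U e hN1 hN2 hρM hL htr hU he hdrP hd
  set V := ∑ i, (U i i + e i i) with hV
  set W := ∑ i, dr i * P i with hW
  have hLV : L = ρ * V + a * W := by
    rw [hL, hV, hW, Finset.mul_sum, Finset.mul_sum, ← Finset.sum_add_distrib]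
    exact Finset.sum_congr rfl fun i _ => by ring
  have hW2 : W ^ 2 ≤ 9 * M * N1 := by
    have h := sq_sum_le_card_mul_sum_sq (s := Finset.univ) (f := fun i => dr i * P i)
    have h2 : ∑ i, (dr i * P i) ^ 2 ≤ ∑ _i : Fin 3, M * N1 :=
      Finset.sum_le_sum fun i _ => hdrP i i
    simp at h h2
    linarith
  have hsplit : d = (ρ * V) ^ 2 + (a + 1) * (ρ * V) * W
      - ∑ j, ∑ k, (ρ ^ 2 * ((U k j + e k j) * (U j k + e j k))
        + (a + 1) * ρ * (dr k * P j * (U j k + e j k))) := by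
    rw [hd, hV, hW]
    simp only [Fin.sum_univ_three]
    ring
  have hterm : ∀ j k, ρ ^ 2 * (U k j * U j k) - 3 * s * M * (ρ ^ 2 * N2) - K * N1
      ≤ ρ ^ 2 * ((U k j + e k j) * (U j k + e j k))
        + (a + 1) * ρ * (dr k * P j * (U j k + e j k)) :=
    fun j k => second_order_term hs0.le (by positivity) (fun _ _ => mul_le_young hs0) hM.le hN1
      hρM (hU k j) (hU j k) (he k j) (he j k) (hdrP k j)
  have hsum := Finset.sum_le_sum fun j (_ : j ∈ Finset.univ) =>
    Finset.sum_le_sum fun k (_ : k ∈ Finset.univ) => hterm j k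
  simp only [Finset.sum_sub_distrib, ← Finset.mul_sum, Finset.sum_const, Finset.card_univ,
    Fintype.card_fin, nsmul_eq_mul] at hsum
  have h1 : ρ ^ 2 * (lam ^ 2 * N2) ≤ ρ ^ 2 * ∑ j, ∑ k, U k j * U j k := by gcongr
  have h2 : 9 * (3 * s * M * (ρ ^ 2 * N2)) = lam ^ 2 / 2 * (ρ ^ 2 * N2) := by
    rw [hs]; field_simp; ring
  have h3 : ρ * V = L - a * W := by linarith
  have h4 : (ρ * V) ^ 2 ≤ 2 * L ^ 2 + 2 * a ^ 2 * W ^ 2 := by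
    rw [h3]; nlinarith [sq_nonneg (L + a * W)]
  have h5 : (a + 1) * (ρ * V) * W ≤ (a + 1) * (L ^ 2 + W ^ 2) := by
    rw [mul_assoc, h3]
    gcongr
    nlinarith [sq_nonneg (L - W), mul_nonneg ha.le (sq_nonneg W), sq_nonneg L, sq_nonneg W]
  have h6 : (2 * a ^ 2 + (a + 1)) * W ^ 2 ≤ (2 * a ^ 2 + (a + 1)) * (9 * M * N1) := by gcongr
  push_cast at hsum
  linarith

end PointwiseAlgebra

lemma pd_sub {n : ℕ} {f g : (Fin n → ℝ) → ℝ} {x : Fin n → ℝ} (i : Fin n)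
    (hf : DifferentiableAt ℝ f x) (hg : DifferentiableAt ℝ g x) :
    pd i (fun y => f y - g y) x = pd i f x - pd i g x := by
  unfold pd
  rw [fderiv_fun_sub hf hg]
  simp

lemma pd_const_mul {n : ℕ} {f : (Fin n → ℝ) → ℝ} {x : Fin n → ℝ} (i : Fin n) (c : ℝ)
    (hf : DifferentiableAt ℝ f x) : pd i (fun y => c * f y) x = c * pd i f x := by
  unfold pd
  rw [fderiv_const_mul hf]
  simp

/-- The weighted derivative `r^{1-a} ∂_i (r^a G)`. -/
noncomputable def wpd {n : ℕ} (a : ℝ) (r : (Fin n → ℝ) → ℝ) (i : Fin n)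
    (G : (Fin n → ℝ) → ℝ) (x : Fin n → ℝ) : ℝ :=
  r x * pd i G x + a * pd i r x * G x

/-- The flux `h^{jl} ∂_l f`. -/
noncomputable def flux {n : ℕ} (h : Fin n → Fin n → (Fin n → ℝ) → ℝ) (f : (Fin n → ℝ) → ℝ)
    (j : Fin n) (x : Fin n → ℝ) : ℝ :=
  ∑ l, h j l x * pd l f x

/-- The operator `r^{1-a} ∂_i (r^a h^{ij} ∂_j f)`. -/
noncomputable def divOp {n : ℕ} (a : ℝ) (r : (Fin n → ℝ) → ℝ)
    (h : Fin n → Fin n → (Fin n → ℝ) → ℝ) (f : (Fin n → ℝ) → ℝ) (x : Fin n → ℝ) : ℝ :=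
  ∑ i, wpd a r i (flux h f i) x

section Identities

variable {n : ℕ} {Ω : Set (Fin n → ℝ)} {r f : (Fin n → ℝ) → ℝ}
  {h : Fin n → Fin n → (Fin n → ℝ) → ℝ}

lemma SmoothUpTo.flux (hΩo : IsOpen Ω) (hu : UniqueDiffOn ℝ (closure Ω))
    (hh : ∀ i j, SmoothUpTo Ω (h i j)) (hf : SmoothUpTo Ω f) (j : Fin n) :
    SmoothUpTo Ω (flux h f j) :=
  .sum _ fun l _ => (hh j l).mul (hf.pd hΩo hu l)

lemma SmoothUpTo.wpd (hΩo : IsOpen Ω) (hu : UniqueDiffOn ℝ (closure Ω)) (a : ℝ)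
    (hr : SmoothUpTo Ω r) (hf : SmoothUpTo Ω f) (i : Fin n) : SmoothUpTo Ω (wpd a r i f) :=
  (hr.mul (hf.pd hΩo hu i)).add (((const a).mul (hr.pd hΩo hu i)).mul hf)

lemma pd_flux (hΩo : IsOpen Ω) (hu : UniqueDiffOn ℝ (closure Ω))
    (hh : ∀ i j, SmoothUpTo Ω (h i j)) (hf : SmoothUpTo Ω f) (k j : Fin n)
    {x : Fin n → ℝ} (hx : x ∈ Ω) :
    pd k (flux h f j) x
      = ∑ l, h j l x * pd k (pd l f) x + ∑ l, pd k (h j l) x * pd l f x := by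
  unfold flux
  rw [pd_sum _ _ fun l _ => ((hh j l).mul (hf.pd hΩo hu l)).differentiableAt hΩo hx,
    ← Finset.sum_add_distrib]
  exact Finset.sum_congr rfl fun l _ =>
    pd_mul k ((hh j l).differentiableAt hΩo hx) ((hf.pd hΩo hu l).differentiableAt hΩo hx)

lemma energy_identity (hΩo : IsOpen Ω) (hu : UniqueDiffOn ℝ (closure Ω))
    (hh : ∀ i j, SmoothUpTo Ω (h i j)) (hf : SmoothUpTo Ω f) (a : ℝ)
    {x : Fin n → ℝ} (hx : x ∈ Ω) :
    ∑ i, wpd a r i (fun y => flux h f i y * f y) x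
      = f x * divOp a r h f x + r x * ∑ i, flux h f i x * pd i f x := by
  unfold divOp wpd
  rw [Finset.mul_sum, Finset.mul_sum, ← Finset.sum_add_distrib]
  refine Finset.sum_congr rfl fun i _ => ?_
  rw [pd_mul i ((SmoothUpTo.flux hΩo hu hh hf i).differentiableAt hΩo hx)
    (hf.differentiableAt hΩo hx)]
  ring

lemma second_order_identity (hΩo : IsOpen Ω) (hu : UniqueDiffOn ℝ (closure Ω))
    (hr : SmoothUpTo Ω r) {P : Fin n → (Fin n → ℝ) → ℝ}
    (hP : ∀ i, SmoothUpTo Ω (P i)) (a : ℝ) {x : Fin n → ℝ} (hx : x ∈ Ω) (j k : Fin n) :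
    wpd a r j (fun y => r y * (P j y * pd k (P k) y)) x
        - wpd a r k (fun y => r y * (P j y * pd j (P k) y)) x
      = r x ^ 2 * (pd j (P j) x * pd k (P k) x - pd k (P j) x * pd j (P k) x)
        + (a + 1) * r x * (pd j r x * P j x * pd k (P k) x
          - pd k r x * P j x * pd j (P k) x) := by
  unfold wpd
  have e : ∀ m l, pd m (fun y => r y * (P j y * pd l (P k) y)) x
      = r x * (P j x * pd m (pd l (P k)) x + pd m (P j) x * pd l (P k) x)
        + pd m r x * (P j x * pd l (P k) x) := by
    intro m l
    rw [pd_mul m (hr.differentiableAt hΩo hx)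
      (((hP j).mul ((hP k).pd hΩo hu l)).differentiableAt hΩo hx),
      pd_mul m ((hP j).differentiableAt hΩo hx) (((hP k).pd hΩo hu l).differentiableAt hΩo hx)]
  rw [e, e, (hP k).pd_comm hΩo j k hx]
  ring

end Identities

lemma rellich_algebra (a ρ : ℝ) (dr p P : Fin 3 → ℝ) (h q ddr : Fin 3 → Fin 3 → ℝ)
    (e dP : Fin 3 → Fin 3 → ℝ) (hh : ∀ i j, h i j = h j i) (hq : ∀ i j, q i j = q j i)
    (hP : ∀ j, P j = ∑ l, h j l * p l) (hdP : ∀ i j, dP i j = ∑ l, h j l * q i l + e i j) :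
    ∑ i, (ρ * ((P i * ∑ k, (dr k * q i k + ddr i k * p k) + dP i i * ∑ k, dr k * p k)
        - 1 / 2 * (dr i * ∑ k, (P k * q i k + dP i k * p k) + ddr i i * ∑ k, P k * p k))
      + a * dr i * (P i * ∑ k, dr k * p k - 1 / 2 * (dr i * ∑ k, P k * p k)))
    = (∑ i, (ρ * dP i i + a * dr i * P i)) * (∑ k, dr k * p k)
      + ρ * (∑ i, P i * ∑ k, ddr i k * p k - 1 / 2 * ((∑ i, ddr i i) * ∑ k, P k * p k)
        - 1 / 2 * ∑ i, ∑ k, dr i * (e i k * p k))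
      - a / 2 * (∑ i, dr i ^ 2) * ∑ k, P k * p k := by
  simp only [hdP, hP, Fin.sum_univ_three, hh 1 0, hh 2 0, hh 2 1, hq 1 0, hq 2 0, hq 2 1]
  ring

lemma rellich_identity {Ω : Set (Fin 3 → ℝ)} {r f : (Fin 3 → ℝ) → ℝ}
    {h : Fin 3 → Fin 3 → (Fin 3 → ℝ) → ℝ} (hΩo : IsOpen Ω) (hu : UniqueDiffOn ℝ (closure Ω))
    (hr : SmoothUpTo Ω r) (hh : ∀ i j, SmoothUpTo Ω (h i j)) (hsymm : ∀ i j x, h i j x = h j i x)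
    (hf : SmoothUpTo Ω f) (a : ℝ) {x : Fin 3 → ℝ} (hx : x ∈ Ω) :
    ∑ i, wpd a r i (fun y => flux h f i y * (∑ k, pd k r y * pd k f y)
        - 1 / 2 * (pd i r y * ∑ k, flux h f k y * pd k f y)) x
      = divOp a r h f x * (∑ k, pd k r x * pd k f x)
        + r x * (∑ i, flux h f i x * ∑ k, pd i (pd k r) x * pd k f x
          - 1 / 2 * ((∑ i, pd i (pd i r) x) * ∑ k, flux h f k x * pd k f x)
          - 1 / 2 * ∑ i, ∑ k, pd i r x * ((∑ l, pd i (h k l) x * pd l f x) * pd k f x))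
        - a / 2 * (∑ i, pd i r x ^ 2) * ∑ k, flux h f k x * pd k f x := by
  have hP : ∀ j, SmoothUpTo Ω (flux h f j) := fun j => .flux hΩo hu hh hf j
  have hT : ∀ k, SmoothUpTo Ω (fun y => pd k r y * pd k f y) := fun k =>
    (hr.pd hΩo hu k).mul (hf.pd hΩo hu k)
  have hS : ∀ k, SmoothUpTo Ω (fun y => flux h f k y * pd k f y) := fun k =>
    (hP k).mul (hf.pd hΩo hu k)
  have hT' := SmoothUpTo.sum Finset.univ fun k _ => hT k
  have hS' := SmoothUpTo.sum Finset.univ fun k _ => hS k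
  have key := rellich_algebra a (r x) (fun i => pd i r x) (fun i => pd i f x)
    (fun i => flux h f i x) (fun i j => h i j x) (fun i j => pd i (pd j f) x)
    (fun i j => pd i (pd j r) x) (fun i j => ∑ l, pd i (h j l) x * pd l f x)
    (fun i j => pd i (flux h f j) x) (fun i j => hsymm i j x) (fun i j => hf.pd_comm hΩo i j hx)
    (fun j => rfl) (fun i j => pd_flux hΩo hu hh hf i j hx)
  unfold divOp wpd
  rw [← key]
  refine Finset.sum_congr rfl fun i _ => ?_
  rw [pd_sub i (((hP i).mul hT').differentiableAt hΩo hx)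
      (((SmoothUpTo.const (1 / 2)).mul ((hr.pd hΩo hu i).mul hS')).differentiableAt hΩo hx),
    pd_const_mul i _ (((hr.pd hΩo hu i).mul hS').differentiableAt hΩo hx),
    pd_mul i ((hP i).differentiableAt hΩo hx) (hT'.differentiableAt hΩo hx),
    pd_mul i ((hr.pd hΩo hu i).differentiableAt hΩo hx) (hS'.differentiableAt hΩo hx),
    pd_sum _ i fun k _ => (hT k).differentiableAt hΩo hx,
    pd_sum _ i fun k _ => (hS k).differentiableAt hΩo hx]
  simp only [pd_mul i ((hr.pd hΩo hu _).differentiableAt hΩo hx)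
      ((hf.pd hΩo hu _).differentiableAt hΩo hx),
    pd_mul i ((hP _).differentiableAt hΩo hx) ((hf.pd hΩo hu _).differentiableAt hΩo hx)]

lemma Aop_eq {Ω : Set (Fin 3 → ℝ)} (hΩo : IsOpen Ω) (hu' : UniqueDiffOn ℝ (closure Ω)) (κ : ℝ)
    {r f : (Fin 3 → ℝ) → ℝ} {u : (Fin 3 → ℝ) → Fin 4 → ℝ} (hr : SmoothUpTo Ω r)
    (hrpos : ∀ x ∈ Ω, 0 < r x) (hh : ∀ i j, SmoothUpTo Ω (Hcoef u i j)) (hf : SmoothUpTo Ω f)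
    {x : Fin 3 → ℝ} (hx : x ∈ Ω) :
    Aop κ r u f x = -(κ + 1) * divOp (1 / κ) r (Hcoef u) f x := by
  have hrx := hrpos x hx
  unfold Aop divOp wpd
  rw [mul_assoc, Finset.mul_sum]
  congr 1
  refine Finset.sum_congr rfl fun i _ => ?_
  have h1 := pd_comp i (Real.hasDerivAt_rpow_const (p := 1 / κ) (Or.inl hrx.ne'))
    (hr.differentiableAt hΩo hx)
  have h2 := pd_mul i ((hr.differentiableAt hΩo hx).rpow_const (p := 1 / κ) (Or.inl hrx.ne'))
    ((SmoothUpTo.flux hΩo hu' hh hf i).differentiableAt hΩo hx)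
  have h3 : r x ^ (1 - 1 / κ) * r x ^ (1 / κ) = r x := by
    rw [← Real.rpow_add hrx]; simp
  have h4 : r x ^ (1 - 1 / κ) * r x ^ (1 / κ - 1) = 1 := by
    rw [← Real.rpow_add hrx]; simp
  change _ * pd i (fun y => r y ^ (1 / κ) * flux (Hcoef u) f i y) x = _
  rw [h2, h1]
  linear_combination pd i (flux (Hcoef u) f i) x * h3
    + 1 / κ * pd i r x * flux (Hcoef u) f i x * h4

lemma quadForm_lower_bound {h : Fin 3 → Fin 3 → ℝ} {v : Fin 3 → ℝ} {lam : ℝ}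
    (hh : ∀ i j, h i j = (if i = j then 1 else 0) - v i * v j)
    (hv : lam ≤ 1 - ∑ i, v i ^ 2) (ξ : Fin 3 → ℝ) :
    lam * ∑ i, ξ i ^ 2 ≤ ∑ i, (∑ j, h i j * ξ j) * ξ i := by
  have hN : 0 ≤ ∑ i, ξ i ^ 2 := Finset.sum_nonneg fun i _ => sq_nonneg _
  refine (mul_le_mul_of_nonneg_right hv hN).trans ?_
  simp only [Fin.sum_univ_three, hh]
  simp
  nlinarith [sq_nonneg (ξ 0 * v 1 - ξ 1 * v 0), sq_nonneg (ξ 0 * v 2 - ξ 2 * v 0),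
    sq_nonneg (ξ 1 * v 2 - ξ 2 * v 1)]

lemma abs_sum_three_le {x : Fin 3 → ℝ} {B : ℝ} (hx : ∀ i, |x i| ≤ B) : |∑ i, x i| ≤ 3 * B :=
  calc |∑ i, x i| ≤ ∑ i, |x i| := Finset.abs_sum_le_sum_abs _ _
    _ ≤ ∑ _i : Fin 3, B := Finset.sum_le_sum fun i _ => hx i
    _ = 3 * B := by simp

lemma rellich_remainder_le {dr p P y : Fin 3 → ℝ} {ddr e : Fin 3 → Fin 3 → ℝ} {m N : ℝ}
    (hm : 1 ≤ m) (hN : 0 ≤ N) (hdr : ∀ i, |dr i| ≤ m) (hddr : ∀ i j, |ddr i j| ≤ m)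
    (hp : ∀ i, p i ^ 2 ≤ N) (hP : ∀ i, P i ^ 2 ≤ 3 * m ^ 2 * N)
    (hy : ∀ i, y i ^ 2 ≤ 3 * m ^ 2 * N) (he : ∀ i j, e i j ^ 2 ≤ 3 * m ^ 2 * N) :
    ∑ k, P k * p k ≤ 36 * m ^ 4 * N ∧
    ∑ i, P i * y i - 1 / 2 * ((∑ i, ddr i i) * ∑ k, P k * p k)
        - 1 / 2 * ∑ i, ∑ k, dr i * (e i k * p k) ≤ 36 * m ^ 4 * N := by
  have hp' : ∀ i, p i ^ 2 ≤ 3 * m ^ 2 * N := fun i => (hp i).trans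
    (le_mul_of_one_le_left hN (by nlinarith))
  set B := 3 * m ^ 2 * N with hB
  have hB0 : 0 ≤ B := by positivity
  have h1 : |∑ k, P k * p k| ≤ 3 * B := abs_sum_three_le fun k => abs_mul_le_of_sq_le (hP k) (hp' k)
  have h2 : |∑ i, P i * y i| ≤ 3 * B := abs_sum_three_le fun k => abs_mul_le_of_sq_le (hP k) (hy k)
  have h3 : |∑ i, ddr i i| ≤ 3 * m := abs_sum_three_le fun i => hddr i i
  have h4 : |(∑ i, ddr i i) * ∑ k, P k * p k| ≤ 3 * m * (3 * B) := by
    rw [abs_mul]; gcongr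
  have h5 : |∑ i, ∑ k, dr i * (e i k * p k)| ≤ 3 * (3 * (m * B)) :=
    abs_sum_three_le fun i => abs_sum_three_le fun k => by
      rw [abs_mul]
      exact mul_le_mul (hdr i) (abs_mul_le_of_sq_le (he i k) (hp' k)) (abs_nonneg _) (by linarith)
  have h6 : B ≤ m * B := by nlinarith
  have h7 : m * B ≤ m ^ 2 * B := by nlinarith
  have h8 : m ^ 2 * B = 3 * m ^ 4 * N := by rw [hB]; ring
  have h1' := abs_le.1 h1
  have h2' := abs_le.1 h2
  have h4' := abs_le.1 h4
  have h5' := abs_le.1 h5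
  constructor <;> linarith

lemma combine_pointwise {κ lam M α β γ η C a : ℝ} (hκ : 0 < κ) (hlam : 0 < lam) (hM : 0 < M)
    (hα : 0 < α) (hβ : 0 < β) (hγ : 0 < γ) (hη : 0 < η) (hC : 0 ≤ C) (ha : 0 < a) :
    ∃ C' c1 c2 c3 : ℝ, 0 ≤ C' ∧ ∀ F L g ρ N1 N2 d1 d2 d3 : ℝ, 0 ≤ ρ → 0 ≤ N1 → ρ ^ 2 ≤ M →
      g = F - (κ + 1) * L →
      F ^ 2 + 2 * (κ + 1) * lam * (ρ * N1) ≤ g ^ 2 + 2 * (κ + 1) * d1 →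
      α * N1 ≤ β * L ^ 2 + γ * (ρ * N1) - d2 →
      η * (ρ ^ 2 * N2) ≤ a * L ^ 2 + C * N1 - d3 →
      ρ ^ 2 * (F ^ 2 + N1 + N2) ≤ C' * g ^ 2 + (c1 * d1 + c2 * d2 + c3 * d3) := by
  set K1 := M + 2 * a / η
  set K2 := M + C / η
  set K3 := 2 * a / η
  set A1 := K1 + K2 / α * (2 * β)
  set A2 := K2 / α * γ
  set A3 := K3 + K2 / α * (2 * β)
  set μ := 2 * (κ + 1) * lam
  have hμ : 0 < μ := by positivity
  have hK2 : 0 ≤ K2 := by positivity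
  have hA1 : 0 ≤ A1 := by positivity
  have hA2 : 0 ≤ A2 := by positivity
  refine ⟨A3 + (A1 + A2 / μ), (A1 + A2 / μ) * (2 * (κ + 1)), -(K2 / α), -(1 / η),
    by positivity, ?_⟩
  intro F L g ρ N1 N2 d1 d2 d3 hρ hN1 hρM hg h1 h2 h3
  have hρN : 0 ≤ ρ * N1 := mul_nonneg hρ hN1
  have hL : L ^ 2 ≤ 2 * (F ^ 2 + g ^ 2) := by
    have e : (κ + 1) * L = F - g := by linarith
    have : L ^ 2 ≤ ((κ + 1) * L) ^ 2 := by
      rw [mul_pow]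
      nlinarith [sq_nonneg L, sq_nonneg κ]
    rw [e] at this
    nlinarith [sq_nonneg (F + g)]
  have t1 : ρ ^ 2 * (F ^ 2 + N1) ≤ M * (F ^ 2 + N1) := by gcongr
  have t2 : ρ ^ 2 * N2 ≤ 1 / η * (a * (2 * (F ^ 2 + g ^ 2)) + C * N1 - d3) := by
    rw [one_div_mul_eq_div, le_div_iff₀ hη]
    nlinarith
  have t3 : K2 * N1 ≤ K2 / α * (β * (2 * (F ^ 2 + g ^ 2)) + γ * (ρ * N1) - d2) := by
    rw [div_mul_eq_mul_div, le_div_iff₀ hα, mul_assoc, mul_comm N1]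
    gcongr
    nlinarith
  have t4 : A1 * F ^ 2 ≤ A1 * (g ^ 2 + 2 * (κ + 1) * d1) := by
    gcongr
    nlinarith [mul_nonneg hμ.le hρN]
  have t5 : A2 * (ρ * N1) ≤ A2 / μ * (g ^ 2 + 2 * (κ + 1) * d1) := by
    rw [div_mul_eq_mul_div, le_div_iff₀ hμ, mul_assoc, mul_comm (ρ * N1)]
    gcongr
    nlinarith [sq_nonneg F]
  have e1 : ρ ^ 2 * (F ^ 2 + N1 + N2) ≤ K1 * F ^ 2 + K2 * N1 + K3 * g ^ 2 - 1 / η * d3 := by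
    have : M * (F ^ 2 + N1) + 1 / η * (a * (2 * (F ^ 2 + g ^ 2)) + C * N1 - d3)
        = K1 * F ^ 2 + K2 * N1 + K3 * g ^ 2 - 1 / η * d3 := by
      simp only [K1, K2, K3]; ring
    linarith
  have e2 : K1 * F ^ 2 + K2 / α * (β * (2 * (F ^ 2 + g ^ 2)) + γ * (ρ * N1) - d2) + K3 * g ^ 2
      = A1 * F ^ 2 + A2 * (ρ * N1) + A3 * g ^ 2 - K2 / α * d2 := by
    simp only [A1, A2, A3]; ring
  linarith

lemma exists_uniform_bound {n : ℕ} {Ω : Set (Fin n → ℝ)} (hΩb : Bornology.IsBounded Ω)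
    {ι : Type*} [Fintype ι] {F : ι → (Fin n → ℝ) → ℝ} (hF : ∀ i, SmoothUpTo Ω (F i)) :
    ∃ M, 0 ≤ M ∧ ∀ i, ∀ x ∈ Ω, |F i x| ≤ M := by
  choose M hM0 hM using fun i => (hF i).exists_bound hΩb
  exact ⟨∑ i, M i, Finset.sum_nonneg fun i _ => hM0 i, fun i x hx =>
    (hM i x hx).trans (Finset.single_le_sum (fun i _ => hM0 i) (Finset.mem_univ i))⟩

/-- The weighted integral of `Φ` exists and vanishes. -/
def WeightedNull {n : ℕ} (Ω : Set (Fin n → ℝ)) (r : (Fin n → ℝ) → ℝ) (b : ℝ)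
    (Φ : (Fin n → ℝ) → ℝ) : Prop :=
  IntegrableOn (fun x => r x ^ (b - 1) * Φ x) Ω ∧ ∫ x in Ω, r x ^ (b - 1) * Φ x = 0

namespace WeightedNull

variable {n : ℕ} {Ω : Set (Fin n → ℝ)} {r : (Fin n → ℝ) → ℝ} {b : ℝ} {Φ Ψ : (Fin n → ℝ) → ℝ}

lemma add (h1 : WeightedNull Ω r b Φ) (h2 : WeightedNull Ω r b Ψ) :
    WeightedNull Ω r b (fun x => Φ x + Ψ x) := by
  simp only [WeightedNull, mul_add]
  exact ⟨h1.1.add h2.1, by rw [integral_add h1.1 h2.1, h1.2, h2.2, add_zero]⟩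

lemma const_mul (c : ℝ) (h1 : WeightedNull Ω r b Φ) :
    WeightedNull Ω r b (fun x => c * Φ x) := by
  simp only [WeightedNull, mul_left_comm _ c]
  exact ⟨h1.1.const_mul c, by rw [integral_const_mul, h1.2, mul_zero]⟩

lemma sub (h1 : WeightedNull Ω r b Φ) (h2 : WeightedNull Ω r b Ψ) :
    WeightedNull Ω r b (fun x => Φ x - Ψ x) := by
  simpa [sub_eq_add_neg] using h1.add (h2.const_mul (-1))

lemma sum {ι : Type*} [Fintype ι] {F : ι → (Fin n → ℝ) → ℝ}
    (h : ∀ i, WeightedNull Ω r b (F i)) : WeightedNull Ω r b (fun x => ∑ i, F i x) := by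
  simp only [WeightedNull, Finset.mul_sum]
  exact ⟨integrable_finsetSum _ fun i _ => (h i).1, by
    rw [integral_finsetSum _ fun i _ => (h i).1]
    exact Finset.sum_eq_zero fun i _ => (h i).2⟩

end WeightedNull

/-- The main pointwise estimate: up to terms of vanishing weighted integral, second order
quantities are controlled by `f - (κ + 1) divOp f`. -/
lemma pointwise_estimate {Ω : Set (Fin 3 → ℝ)} (hΩo : IsOpen Ω) (hΩb : Bornology.IsBounded Ω)
    (hu : UniqueDiffOn ℝ (closure Ω)) {κ : ℝ} (hκ : 0 < κ) {r : (Fin 3 → ℝ) → ℝ}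
    (hr : SmoothUpTo Ω r) (hrpos : ∀ x ∈ Ω, 0 < r x)
    {c : ℝ} (hc : 0 < c) (hcr : ∀ x ∈ Ω, c ≤ ∑ i, pd i r x ^ 2 + r x)
    {h : Fin 3 → Fin 3 → (Fin 3 → ℝ) → ℝ} (hh : ∀ i j, SmoothUpTo Ω (h i j))
    {v : (Fin 3 → ℝ) → Fin 3 → ℝ}
    (hv : ∀ i j x, h i j x = (if i = j then 1 else 0) - v x i * v x j)
    {lam : ℝ} (hlam : 0 < lam) (hvl : ∀ x ∈ Ω, lam ≤ 1 - ∑ i, v x i ^ 2)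
    {a : ℝ} (ha : 0 < a)
    (hnull : ∀ G, SmoothUpTo Ω G → ∀ i, WeightedNull Ω r a (wpd a r i G)) :
    ∃ C, 0 ≤ C ∧ ∀ f, SmoothUpTo Ω f → ∃ Φ, WeightedNull Ω r a Φ ∧ ∀ x ∈ Ω,
      r x ^ 2 * (f x ^ 2 + ∑ i, pd i f x ^ 2 + ∑ i, ∑ j, pd i (pd j f) x ^ 2)
        ≤ C * (f x - (κ + 1) * divOp a r h f x) ^ 2 + Φ x := by
  have hsymm : ∀ i j x, h i j x = h j i x := fun i j x => by
    rw [hv, hv, mul_comm]; simp [eq_comm]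
  obtain ⟨m1, hm10, hm1⟩ := exists_uniform_bound hΩb (fun i : Fin 3 × Fin 3 => hh i.1 i.2)
  obtain ⟨m2, hm20, hm2⟩ := exists_uniform_bound hΩb
    (fun i : Fin 3 × Fin 3 × Fin 3 => (hh i.2.1 i.2.2).pd hΩo hu i.1)
  obtain ⟨m3, hm30, hm3⟩ := exists_uniform_bound hΩb (fun i : Fin 3 => hr.pd hΩo hu i)
  obtain ⟨m4, hm40, hm4⟩ := exists_uniform_bound hΩb
    (fun i : Fin 3 × Fin 3 => (hr.pd hΩo hu i.2).pd hΩo hu i.1)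
  obtain ⟨m5, hm50, hm5⟩ := hr.exists_bound hΩb
  set m := 1 + m1 + m2 + m3 + m4 + m5 with hm
  have hmge : 1 ≤ m := by linarith
  have bh : ∀ x ∈ Ω, ∀ i j, |h i j x| ≤ m := fun x hx i j => by linarith [hm1 (i, j) x hx]
  have bdh : ∀ x ∈ Ω, ∀ k i j, |pd k (h i j) x| ≤ m := fun x hx k i j => by
    linarith [hm2 (k, i, j) x hx]
  have bdr : ∀ x ∈ Ω, ∀ i, |pd i r x| ≤ m := fun x hx i => by linarith [hm3 i x hx]
  have bddr : ∀ x ∈ Ω, ∀ i j, |pd i (pd j r) x| ≤ m := fun x hx i j => by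
    linarith [hm4 (i, j) x hx]
  have br : ∀ x ∈ Ω, |r x| ≤ m := fun x hx => by linarith [hm5 x hx]
  obtain ⟨M, hMdef⟩ : ∃ M, M = 36 * m ^ 4 := ⟨_, rfl⟩
  clear_value m
  have hm24 : m ^ 2 ≤ m ^ 4 := pow_le_pow_right₀ hmge (by norm_num)
  have hm2 := sq_nonneg m
  have hM : 0 < M := by rw [hMdef]; positivity
  have h3M : 3 * m ^ 2 ≤ M := by linarith
  have hm2M : m ^ 2 ≤ M := by linarith
  have h33M : m ^ 2 * (3 * m ^ 2) ≤ M := by linarith [mul_nonneg hm2 hm2]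
  obtain ⟨C2, hC2, hsecond⟩ := second_order_pointwise ha hlam hM
  obtain ⟨C', c1, c2, c3, hC', hcomb⟩ := combine_pointwise (κ := κ) (lam := lam) (M := M)
    (α := a * c * lam / 4) (β := M / (a * c * lam)) (γ := (1 + a / 2) * M)
    (η := lam ^ 2 / 2) (C := C2) (a := a + 3) hκ hlam hM (by positivity) (by positivity)
    (by positivity) (by positivity) hC2 (by positivity)
  refine ⟨C', hC', fun f hf => ?_⟩
  have hP : ∀ j, SmoothUpTo Ω (flux h f j) := fun j => .flux hΩo hu hh hf j
  refine ⟨fun x => c1 * (∑ i, wpd a r i (fun y => flux h f i y * f y) x)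
    + c2 * (∑ i, wpd a r i (fun y => flux h f i y * (∑ k, pd k r y * pd k f y)
        - 1 / 2 * (pd i r y * ∑ k, flux h f k y * pd k f y)) x)
    + c3 * (∑ j, ∑ k, (wpd a r j (fun y => r y * (flux h f j y * pd k (flux h f k) y)) x
        - wpd a r k (fun y => r y * (flux h f j y * pd j (flux h f k) y)) x)), ?_, ?_⟩
  · refine ((WeightedNull.const_mul c1 ?_).add (WeightedNull.const_mul c2 ?_)).add
      (WeightedNull.const_mul c3 ?_)
    · exact WeightedNull.sum fun i => hnull _ ((hP i).mul hf) i
    · refine WeightedNull.sum fun i => hnull _ (((hP i).mul ?_).sub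
        ((SmoothUpTo.const _).mul ((hr.pd hΩo hu i).mul ?_))) i
      · exact SmoothUpTo.sum _ fun k _ => (hr.pd hΩo hu k).mul (hf.pd hΩo hu k)
      · exact SmoothUpTo.sum _ fun k _ => (hP k).mul (hf.pd hΩo hu k)
    · exact WeightedNull.sum fun j => WeightedNull.sum fun k =>
        (hnull _ (hr.mul ((hP j).mul ((hP k).pd hΩo hu k))) j).sub
          (hnull _ (hr.mul ((hP j).mul ((hP k).pd hΩo hu j))) k)
  intro x hx
  have hrx := hrpos x hx
  set N1 := ∑ i, pd i f x ^ 2 with hN1def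
  set N2 := ∑ i, ∑ j, pd i (pd j f) x ^ 2 with hN2def
  have hN1 : 0 ≤ N1 := Finset.sum_nonneg fun i _ => sq_nonneg _
  have hN2 : 0 ≤ N2 := Finset.sum_nonneg fun i _ => Finset.sum_nonneg fun j _ => sq_nonneg _
  have hp : ∀ i, pd i f x ^ 2 ≤ N1 := fun i =>
    Finset.single_le_sum (f := fun i => pd i f x ^ 2) (fun i _ => sq_nonneg _) (Finset.mem_univ i)
  have hq : ∀ i, ∑ j, pd i (pd j f) x ^ 2 ≤ N2 := fun i =>
    Finset.single_le_sum (f := fun i => ∑ j, pd i (pd j f) x ^ 2)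
      (fun i _ => Finset.sum_nonneg fun j _ => sq_nonneg _) (Finset.mem_univ i)
  have hPN : ∀ i, flux h f i x ^ 2 ≤ 3 * m ^ 2 * N1 := fun i => sq_sum_mul_le (bh x hx i)
  have hTN : (∑ k, pd k r x * pd k f x) ^ 2 ≤ 3 * m ^ 2 * N1 := sq_sum_mul_le (bdr x hx)
  have hyN : ∀ i, (∑ k, pd i (pd k r) x * pd k f x) ^ 2 ≤ 3 * m ^ 2 * N1 := fun i =>
    sq_sum_mul_le (bddr x hx i)
  have heN : ∀ i j, (∑ l, pd i (h j l) x * pd l f x) ^ 2 ≤ 3 * m ^ 2 * N1 := fun i j =>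
    sq_sum_mul_le (bdh x hx i j)
  have hUN : ∀ j k, (∑ l, h k l x * pd j (pd l f) x) ^ 2 ≤ M * N2 := fun j k => by
    refine (sq_sum_mul_le (bh x hx k)).trans ?_
    exact mul_le_mul h3M (hq j) (Finset.sum_nonneg fun l _ => sq_nonneg _) hM.le
  have hweak : 3 * m ^ 2 * N1 ≤ M * N1 := by gcongr
  have hSlow : lam * N1 ≤ ∑ k, flux h f k x * pd k f x :=
    quadForm_lower_bound (fun i j => hv i j x) (hvl x hx) _
  obtain ⟨hSup, hQ⟩ := rellich_remainder_le (e := fun i k => ∑ l, pd i (h k l) x * pd l f x)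
    hmge hN1 (bdr x hx) (bddr x hx) hp hPN hyN heN
  rw [← hMdef] at hSup hQ
  have hρM : r x ^ 2 ≤ M :=
    (sq_le_sq' (abs_le.1 (br x hx)).1 (abs_le.1 (br x hx)).2).trans hm2M
  have hdrP : ∀ j k, (pd j r x * flux h f k x) ^ 2 ≤ M * N1 := fun j k => by
    rw [mul_pow]
    have h1 : pd j r x ^ 2 ≤ m ^ 2 :=
      sq_le_sq' (abs_le.1 (bdr x hx j)).1 (abs_le.1 (bdr x hx j)).2
    refine (mul_le_mul h1 (hPN k) (sq_nonneg _) (by positivity)).trans ?_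
    rw [← mul_assoc]
    exact mul_le_mul_of_nonneg_right h33M hN1
  have hdiv : divOp a r h f x = ∑ i, (r x * ((∑ l, h i l x * pd i (pd l f) x)
      + ∑ l, pd i (h i l) x * pd l f x) + a * pd i r x * flux h f i x) := by
    simp only [← pd_flux hΩo hu hh hf _ _ hx]
    rfl
  have hsec := Finset.sum_congr (rfl : (Finset.univ : Finset (Fin 3)) = _) fun j _ =>
    Finset.sum_congr (rfl : (Finset.univ : Finset (Fin 3)) = _) fun k _ =>
      second_order_identity hΩo hu hr hP a hx j k
  simp only [pd_flux hΩo hu hh hf _ _ hx] at hsec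
  have htr := trace_sq_lower_bound (q := fun i j => pd i (pd j f) x)
    (fun i j => hv i j x) hlam.le (hvl x hx) fun i j => hf.pd_comm hΩo i j hx
  have E1 := energy_pointwise hκ hrx.le rfl hSlow (energy_identity hΩo hu hh hf a hx)
  have E2 := rellich_pointwise ha hc hlam hM hrx.le hN1 (by linarith [hcr x hx]) hSlow hSup
    (hTN.trans hweak) hQ (rellich_identity hΩo hu hr hh hsymm hf a hx)
  have E3 := hsecond (divOp a r h f x) (r x) N1 N2 _ (fun i => pd i r x) (fun i => flux h f i x)
    (fun k j => ∑ l, h j l x * pd k (pd l f) x) (fun k j => ∑ l, pd k (h j l) x * pd l f x)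
    hN1 hN2 hρM hdiv htr hUN (fun j k => (heN j k).trans hweak) hdrP hsec
  exact hcomb _ _ _ _ _ _ _ _ _ hrx.le hN1 hρM rfl E1 E2 E3

lemma SmoothUpTo.mderiv {n k : ℕ} {Ω : Set (Fin n → ℝ)} {f : (Fin n → ℝ) → ℝ}
    (hf : SmoothUpTo Ω f) (hΩo : IsOpen Ω) (hu : UniqueDiffOn ℝ (closure Ω))
    (β : Fin k → Fin n) : SmoothUpTo Ω (mderiv β f) := by
  unfold _root_.mderiv
  induction List.ofFn β with
  | nil => exact hf
  | cons i l ih => exact ih.pd hΩo hu i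

lemma sq_mderiv_le {k : ℕ} (hk : k < 3) (β : Fin k → Fin 3) (f : (Fin 3 → ℝ) → ℝ)
    (x : Fin 3 → ℝ) :
    mderiv β f x ^ 2 ≤ f x ^ 2 + ∑ i, pd i f x ^ 2 + ∑ i, ∑ j, pd i (pd j f) x ^ 2 := by
  have hN1 : 0 ≤ ∑ i, pd i f x ^ 2 := Finset.sum_nonneg fun i _ => sq_nonneg _
  have hN2 : 0 ≤ ∑ i, ∑ j, pd i (pd j f) x ^ 2 :=
    Finset.sum_nonneg fun i _ => Finset.sum_nonneg fun j _ => sq_nonneg _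
  have hN0 := sq_nonneg (f x)
  interval_cases k
  · simp only [mderiv, List.ofFn_zero, List.foldr_nil]
    linarith
  · simp only [mderiv, List.ofFn_succ, List.ofFn_zero, List.foldr_cons, List.foldr_nil]
    have := Finset.single_le_sum (f := fun i => pd i f x ^ 2) (fun i _ => sq_nonneg _)
      (Finset.mem_univ (β 0))
    linarith
  · simp only [mderiv, List.ofFn_succ, List.ofFn_zero, List.foldr_cons, List.foldr_nil]
    have h1 := Finset.single_le_sum (f := fun i => ∑ j, pd i (pd j f) x ^ 2)
      (fun i _ => Finset.sum_nonneg fun j _ => sq_nonneg _) (Finset.mem_univ (β 0))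
    have h2 := Finset.single_le_sum (f := fun j => pd (β 0) (pd j f) x ^ 2)
      (fun i _ => sq_nonneg _) (Finset.mem_univ (β 1))
    exact (h2.trans h1).trans (by linarith)

/-- The weight is a nondegenerate defining function: its gradient is bounded below near the
boundary. -/
lemma exists_gradient_lower_bound {n : ℕ} {Ω : Set (Fin n → ℝ)} (hΩo : IsOpen Ω)
    (hΩb : Bornology.IsBounded Ω) (hu : UniqueDiffOn ℝ (closure Ω)) {r : (Fin n → ℝ) → ℝ}
    (hr : ContDiffOn ℝ ∞ r (closure Ω)) (hrpos : ∀ x ∈ Ω, 0 < r x)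
    (hr0 : ∀ x ∈ frontier Ω, r x = 0) (hrgrad : ∀ x ∈ frontier Ω, fderiv ℝ r x ≠ 0) :
    ∃ c, 0 < c ∧ ∀ x ∈ Ω, c ≤ ∑ i, pd i r x ^ 2 + r x := by
  rcases Ω.eq_empty_or_nonempty with rfl | hne
  · exact ⟨1, one_pos, by simp⟩
  set q : (Fin n → ℝ) → ℝ := fun x =>
    ∑ i, fderivWithin ℝ r (closure Ω) x (Pi.single i 1) ^ 2 + r x with hq
  have hqc : ContinuousOn q (closure Ω) := by
    have := hr.continuousOn_fderivWithin hu (by simp)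
    exact (continuousOn_finsetSum _ fun i _ => (this.clm_apply continuousOn_const).pow 2).add
      hr.continuousOn
  obtain ⟨x₀, hx₀, hmin⟩ := hΩb.isCompact_closure.exists_isMinOn hne.closure hqc
  have hsum : ∀ x, 0 ≤ ∑ i, fderivWithin ℝ r (closure Ω) x (Pi.single i 1) ^ 2 := fun x =>
    Finset.sum_nonneg fun i _ => sq_nonneg _
  refine ⟨q x₀, ?_, fun x hx => ?_⟩
  · by_cases hx : x₀ ∈ Ω
    · exact add_pos_of_nonneg_of_pos (hsum _) (hrpos _ hx)
    · have hfr : x₀ ∈ frontier Ω := ⟨hx₀, by rwa [hΩo.interior_eq]⟩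
      have hd : DifferentiableAt ℝ r x₀ := by
        by_contra h
        exact hrgrad x₀ hfr (fderiv_zero_of_not_differentiableAt h)
      simp only [hq, hr0 x₀ hfr, add_zero, hd.fderivWithin (hu x₀ hx₀)]
      refine lt_of_le_of_ne (Finset.sum_nonneg fun i _ => sq_nonneg _) fun h0 => ?_
      apply hrgrad x₀ hfr
      have h1 := (Finset.sum_eq_zero_iff_of_nonneg fun i _ => sq_nonneg _).1 h0.symm
      refine ContinuousLinearMap.coe_injective (LinearMap.pi_ext' fun i => ?_)
      ext
      simpa using h1 i (Finset.mem_univ i)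
  · have h1 : closure Ω ∈ 𝓝 x := mem_of_superset (hΩo.mem_nhds hx) subset_closure
    have := isMinOn_iff.1 hmin x (subset_closure hx)
    simpa [hq, pd, fderivWithin_of_mem_nhds h1] using this

/-- **Invertible weighted elliptic estimate** (Corollary 3.10 of the paper):
`‖f‖_{H^{2,1/(2κ)+1/2}} ≲ ‖(A + I) f‖_{H^{0,1/(2κ)-1/2}}`. -/
theorem elliptic_estimate_A_plus_I (Ω : Set (Fin 3 → ℝ))
    (hΩo : IsOpen Ω) (hΩb : Bornology.IsBounded Ω) (hΩs : HasSmoothBoundary Ω)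
    (κ : ℝ) (hκ : 0 < κ)
    (r : (Fin 3 → ℝ) → ℝ) (hr : ContDiffOn ℝ (⊤ : ℕ∞) r (closure Ω))
    (hrpos : ∀ x ∈ Ω, 0 < r x) (hr0 : ∀ x ∈ frontier Ω, r x = 0)
    (hrgrad : ∀ x ∈ frontier Ω, fderiv ℝ r x ≠ 0)
    (u : (Fin 3 → ℝ) → Fin 4 → ℝ)
    (hu : ∀ α, ContDiffOn ℝ (⊤ : ℕ∞) (fun x => u x α) (closure Ω))
    (hu0 : ∀ x ∈ closure Ω, 0 < u x 0)
    (hunorm : ∀ x ∈ closure Ω,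
      -(u x 0) ^ 2 + (u x 1) ^ 2 + (u x 2) ^ 2 + (u x 3) ^ 2 = -1) :
    ∃ C > 0, ∀ f : (Fin 3 → ℝ) → ℝ, ContDiffOn ℝ (⊤ : ℕ∞) f (closure Ω) →
      rSobNorm Ω r 2 (1/(2*κ) + 1/2) f
        ≤ C * rSobNorm Ω r 0 (1/(2*κ) - 1/2) (fun x => Aop κ r u f x + f x) := by
  have hu' := uniqueDiffOn_closure_of_hasSmoothBoundary hΩo hΩs
  obtain ⟨c, hc, hcr⟩ := exists_gradient_lower_bound hΩo hΩb hu' hr hrpos hr0 hrgrad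
  have hrs : SmoothUpTo Ω r := .of_contDiffOn hr
  have hh : ∀ i j, SmoothUpTo Ω (Hcoef u i j) := fun i j =>
    .of_contDiffOn (contDiffOn_const.sub (((hu i.succ).mul (hu j.succ)).div ((hu 0).pow 2)
      fun x hx => (pow_pos (hu0 x hx) 2).ne'))
  have ha : 0 < 1 / κ := by positivity
  have hri := integrableOn_rpow_sub_one hΩo hΩb hu' hr hrpos hr0 hc hcr ha
  obtain ⟨U, hU0, hU⟩ := (SmoothUpTo.of_contDiffOn (hu 0)).exists_bound hΩb
  obtain ⟨C, hC, hest⟩ := pointwise_estimate hΩo hΩb hu' hκ hrs hrpos hc hcr hh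
    (v := fun x i => u x i.succ / u x 0) (lam := 1 / (U + 1) ^ 2)
    (fun i j x => by simp only [Hcoef]; ring) (by positivity)
    (fun x hx => by
      have h0 := hu0 x (subset_closure hx)
      have h1 := hunorm x (subset_closure hx)
      have h2 : u x 0 ≤ U + 1 := by linarith [(abs_le.1 (hU x hx)).2]
      have h3 : 1 - ∑ i : Fin 3, (u x i.succ / u x 0) ^ 2 = 1 / u x 0 ^ 2 := by
        simp only [Fin.sum_univ_three, Fin.succ_zero_eq_one, Fin.succ_one_eq_two,
          show (2 : Fin 3).succ = 3 from rfl]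
        field_simp
        linarith
      rw [h3]
      gcongr) ha
    (fun G hG i => ⟨integrableOn_rpow_mul hΩo hΩb hri (SmoothUpTo.wpd hΩo hu' _ hrs hG i),
      integral_weighted_ibp hΩo hΩb hu' hr hrpos hr0 hri hG i⟩)
  set T : ℝ := ∑ k ∈ Finset.range 3, ∑ _β : Fin k → Fin 3, C with hT
  have hT0 : 0 ≤ T := Finset.sum_nonneg fun k _ => Finset.sum_nonneg fun _ _ => hC
  refine ⟨√T + 1, by positivity, fun f hf => ?_⟩
  have hfs : SmoothUpTo Ω f := .of_contDiffOn hf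
  obtain ⟨Φ, hΦ, hpt⟩ := hest f hfs
  have hgs : SmoothUpTo Ω (fun x => f x - (κ + 1) * divOp (1 / κ) r (Hcoef u) f x) :=
    hfs.sub ((SmoothUpTo.const _).mul (SmoothUpTo.sum _ fun i _ =>
      SmoothUpTo.wpd hΩo hu' _ hrs (SmoothUpTo.flux hΩo hu' hh hfs i) i))
  have hg : EqOn (fun x => Aop κ r u f x + f x)
      (fun x => f x - (κ + 1) * divOp (1 / κ) r (Hcoef u) f x) Ω := fun x hx => by
    simp only [Aop_eq hΩo hu' κ hrs hrpos hh hfs hx]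
    ring
  set J := ∫ x in Ω, r x ^ (1 / κ - 1) * (Aop κ r u f x + f x) ^ 2 with hJ
  have hJ0 : 0 ≤ J := setIntegral_nonneg hΩo.measurableSet fun x hx =>
    mul_nonneg (Real.rpow_nonneg (hrpos x hx).le _) (sq_nonneg _)
  have hterm : ∀ k ∈ Finset.range 3, ∀ β : Fin k → Fin 3,
      ∫ x in Ω, r x ^ (2 * (1 / (2 * κ) + 1 / 2)) * mderiv β f x ^ 2 ≤ C * J := by
    intro k hk β
    have hms := hfs.mderiv hΩo hu' β
    have hL : ∀ x ∈ Ω, r x ^ (2 * (1 / (2 * κ) + 1 / 2)) * mderiv β f x ^ 2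
        = r x ^ (1 / κ - 1) * (r x * r x * (mderiv β f x * mderiv β f x)) := fun x hx => by
      have : r x ^ (2 * (1 / (2 * κ) + 1 / 2)) = r x ^ (1 / κ - 1) * r x ^ 2 := by
        rw [← Real.rpow_add_natCast (hrpos x hx).ne']
        congr 1
        field_simp
        push_cast
        ring
      rw [this]
      ring
    have hGi : IntegrableOn (fun x => C * (r x ^ (1 / κ - 1)
        * (Aop κ r u f x + f x) ^ 2)) Ω := by
      refine Integrable.const_mul ?_ C
      refine (integrableOn_rpow_mul hΩo hΩb hri
        ((hgs.congr hg).mul (hgs.congr hg))).congr_fun (fun x _ => ?_) hΩo.measurableSet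
      simp only [sq]
    calc ∫ x in Ω, r x ^ (2 * (1 / (2 * κ) + 1 / 2)) * mderiv β f x ^ 2
        = ∫ x in Ω, r x ^ (1 / κ - 1) * (r x * r x * (mderiv β f x * mderiv β f x)) :=
          setIntegral_congr_fun hΩo.measurableSet hL
      _ ≤ ∫ x in Ω, (C * (r x ^ (1 / κ - 1) * (Aop κ r u f x + f x) ^ 2)
            + r x ^ (1 / κ - 1) * Φ x) := by
          refine setIntegral_mono_on
            (integrableOn_rpow_mul hΩo hΩb hri ((hrs.mul hrs).mul (hms.mul hms)))
            (hGi.add hΦ.1) hΩo.measurableSet fun x hx => ?_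
          have h1 := sq_mderiv_le (Finset.mem_range.1 hk) β f x
          have h2 := (mul_le_mul_of_nonneg_left h1 (sq_nonneg (r x))).trans (hpt x hx)
          have h3 : 0 ≤ r x ^ (1 / κ - 1) := Real.rpow_nonneg (hrpos x hx).le _
          have h4 := mul_le_mul_of_nonneg_left h2 h3
          have h5 := hg hx
          simp only at h5
          rw [h5]
          linarith
      _ = C * J := by
          rw [integral_add hGi hΦ.1, hΦ.2, add_zero, integral_const_mul]
  have hleft : rSobNorm Ω r 2 (1 / (2 * κ) + 1 / 2) f ≤ √(T * J) := by
    unfold rSobNorm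
    refine Real.sqrt_le_sqrt ?_
    rw [hT, Finset.sum_mul]
    refine Finset.sum_le_sum fun k hk => ?_
    rw [Finset.sum_mul]
    exact Finset.sum_le_sum fun β _ => hterm k hk β
  have hright : rSobNorm Ω r 0 (1 / (2 * κ) - 1 / 2) (fun x => Aop κ r u f x + f x) = √J := by
    have : 2 * (1 / (2 * κ) - 1 / 2) = 1 / κ - 1 := by field_simp
    simp only [rSobNorm, this, hJ]
    simp [mderiv]
  rw [hright]
  refine hleft.trans ?_
  rw [Real.sqrt_mul hT0]
  gcongr
  linarith
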